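/- arXiv:0912.1414 — 4 statements merged into one kernel-verified Lean document; each statement's English description precedes it below -/
import Mathlib

section
/- For every multiplicative character χ of order 20 of the finite field F_q with q = 13^4 = 28561, the Gauss sum G(χ) = Σ_{x ∈ F_q} χ(x) ψ(x) ∈ ℂ satisfies G(χ) ∈ {169·i, −169·i}; that is, G(χ) = ±13²·i. -/
namespace GaussSumCard28561

/-- Quadruples of natural numbers, standing for the elements `a + b α + c α² + d α³` of a field
of characteristic `13` in which `α ^ 4 = 2`. -/
abbrev Quad := ℕ × ℕ × ℕ × ℕ

namespace Quad

/-- Multiplication modulo `13` and `α ^ 4 - 2`. -/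
def mul (x y : Quad) : Quad :=
  match x, y with
  | (a₀, a₁, a₂, a₃), (b₀, b₁, b₂, b₃) =>
    ((a₀ * b₀ + 2 * (a₁ * b₃ + a₂ * b₂ + a₃ * b₁)) % 13,
     (a₀ * b₁ + a₁ * b₀ + 2 * (a₂ * b₃ + a₃ * b₂)) % 13,
     (a₀ * b₂ + a₁ * b₁ + a₂ * b₀ + 2 * (a₃ * b₃)) % 13,
     (a₀ * b₃ + a₁ * b₂ + a₂ * b₁ + a₃ * b₀) % 13)

/-- `pow x f n` is the `n`-th power of `x`, by repeated squaring, provided that `n < 2 ^ f`. -/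
def pow (x : Quad) : ℕ → ℕ → Quad
  | 0, _ => (1, 0, 0, 0)
  | f + 1, n =>
    let y := pow x f (n / 2)
    let z := mul y y
    if n % 2 = 1 then mul z x else z

/-- The element of `F` represented by a quadruple. -/
def eval {F : Type*} [Field F] (α : F) (x : Quad) : F :=
  x.1 + x.2.1 * α + x.2.2.1 * α ^ 2 + x.2.2.2 * α ^ 3

/-- A generator of the multiplicative group. -/
def gen : Quad := (0, 0, 1, 2)

/-- The `1428`-th power of `gen`, an element of order `20`. -/
def unit20 : Quad := (11, 11, 6, 5)

/-- Discrete logarithms modulo `20` of `α + c α² + d α³`, to base `gen`. -/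
def logTable : List (List ℕ) := [
  [15, 15, 5, 15, 5, 15, 5, 5, 15, 5, 15, 5, 15],
  [17, 2, 10, 13, 7, 6, 9, 17, 8, 1, 15, 4, 5],
  [6, 19, 15, 4, 1, 14, 11, 2, 9, 14, 16, 16, 8],
  [18, 4, 8, 8, 2, 17, 6, 3, 2, 13, 12, 15, 7],
  [15, 14, 11, 0, 17, 2, 0, 1, 7, 8, 1, 11, 2],
  [9, 5, 8, 15, 17, 16, 9, 13, 2, 19, 1, 10, 14],
  [15, 6, 3, 13, 4, 11, 13, 0, 6, 1, 0, 3, 2],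
  [15, 14, 7, 17, 16, 19, 17, 0, 14, 9, 0, 7, 18],
  [1, 5, 12, 15, 13, 4, 1, 17, 18, 11, 9, 10, 6],
  [15, 6, 19, 0, 13, 18, 0, 9, 3, 12, 9, 19, 18],
  [2, 16, 12, 12, 18, 13, 14, 7, 18, 17, 8, 15, 3],
  [14, 11, 15, 16, 9, 6, 19, 18, 1, 6, 4, 4, 12],
  [13, 18, 10, 17, 3, 14, 1, 13, 12, 9, 15, 16, 5]]

/-- Discrete logarithm modulo `20` of `α + c α² + d α³`. -/
def log₁ (x : Fin 13 × Fin 13) : ℕ := (logTable.getD x.1 []).getD x.2 0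

/-- Discrete logarithm modulo `20` of `α² + d α³`. -/
def log₂ (d : Fin 13) : ℕ := [10, 12, 1, 13, 10, 4, 10, 10, 16, 10, 17, 9, 8].getD d 0

theorem pow_gen : pow gen 11 1428 = unit20 := by decide +kernel

theorem pow_gen_ne_one : ∀ p ∈ [2, 3, 5, 7, 17], pow gen 15 (28560 / p) ≠ (1, 0, 0, 0) := by
  decide +kernel

theorem pow_gen_lt : ∀ p ∈ [2, 3, 5, 7, 17], (pow gen 15 (28560 / p)).1 < 13 ∧
    (pow gen 15 (28560 / p)).2.1 < 13 ∧ (pow gen 15 (28560 / p)).2.2.1 < 13 ∧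
    (pow gen 15 (28560 / p)).2.2.2 < 13 := by
  decide +kernel

theorem log₁_lt : ∀ x, log₁ x < 20 := by decide +kernel

theorem log₂_lt : ∀ d, log₂ d < 20 := by decide +kernel

theorem pow_log₁ : ∀ x : Fin 13 × Fin 13,
    pow (0, 1, x.1, x.2) 11 1428 = pow unit20 5 (log₁ x) := by
  decide +kernel

theorem pow_log₂ : ∀ d : Fin 13, pow (0, 0, 1, d) 11 1428 = pow unit20 5 (log₂ d) := by
  decide +kernel

theorem pow_log₃ : pow (0, 0, 0, 1) 11 1428 = pow unit20 5 5 := by decide +kernel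

theorem card_log₁ : ∀ k : Fin 20, (Finset.univ.filter fun x => log₁ x = k).card =
    [8, 10, 9, 6, 7, 10, 9, 6, 7, 10, 4, 6, 7, 10, 9, 19, 7, 10, 9, 6].getD k 0 := by
  decide +kernel

theorem card_log₂ : ∀ k : Fin 20, (Finset.univ.filter fun d => log₂ d = k).card =
    [0, 1, 0, 0, 1, 0, 0, 0, 1, 1, 5, 0, 1, 1, 0, 0, 1, 1, 0, 0].getD k 0 := by
  decide +kernel

section Eval

variable {F : Type*} [Field F] [CharP F 13] {α : F}

theorem eval_mul (hα : α ^ 4 = 2) (x y : Quad) :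
    eval α (mul x y) = eval α x * eval α y := by
  have hmod (n : ℕ) : ((n % 13 : ℕ) : F) = n := by
    rw [CharP.cast_eq_iff_mod_eq F 13, Nat.mod_mod]
  obtain ⟨a₀, a₁, a₂, a₃⟩ := x
  obtain ⟨b₀, b₁, b₂, b₃⟩ := y
  simp only [mul, eval, hmod]
  push_cast
  linear_combination (-(a₁ * b₃ + a₂ * b₂ + a₃ * b₁) - (a₂ * b₃ + a₃ * b₂) * α
    - a₃ * b₃ * α ^ 2 : F) * hα

theorem eval_pow (hα : α ^ 4 = 2) (x : Quad) (f n : ℕ) (hn : n < 2 ^ f) :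
    eval α (pow x f n) = eval α x ^ n := by
  induction f generalizing n with
  | zero =>
    obtain rfl : n = 0 := by simpa using hn
    simp [pow, eval]
  | succ f ih =>
    have ih' := ih (n / 2) (by rw [pow_succ] at hn; omega)
    have hdiv := Nat.div_add_mod n 2
    simp only [pow]
    split_ifs with h
    · rw [eval_mul hα, eval_mul hα, ih', ← pow_add, ← pow_succ]
      congr 1
      omega
    · rw [eval_mul hα, ih', ← pow_add]
      congr 1
      omega

end Eval

end Quad

open Quad

/-- The sum of a homogeneous function of degree zero, weighted by a
function of the first coordinate. -/
theorem sum_mul_of_homogeneous {K W : Type*} [Field K] [Fintype K] [DecidableEq K]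
    [AddCommGroup W] [Module K W] [Fintype W] (h : K → W → ℂ)
    (hh : ∀ t : K, t ≠ 0 → ∀ a w, h (t * a) (t • w) = h a w) (φ : K → ℂ) :
    ∑ a, ∑ w, h a w * φ a = φ 0 * ∑ w, h 0 w + (∑ a, φ a - φ 0) * ∑ w, h 1 w := by
  have key (a : K) (ha : a ≠ 0) : ∑ w, h a w = ∑ w, h 1 w := by
    rw [← Equiv.sum_comp (MulAction.toPerm (Units.mk0 a ha) : Equiv.Perm W)]
    refine Finset.sum_congr rfl fun w _ => ?_
    simpa [Units.smul_def] using hh a ha 1 w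
  simp_rw [← Finset.sum_mul]
  have hsum : ∑ a ∈ Finset.univ.erase 0, (∑ w, h a w) * φ a =
      ∑ a ∈ Finset.univ.erase 0, (∑ w, h 1 w) * φ a :=
    Finset.sum_congr rfl fun a ha => by rw [key a (Finset.ne_of_mem_erase ha)]
  rw [← Finset.add_sum_erase _ (fun a => (∑ w, h a w) * φ a) (Finset.mem_univ (0 : K)),
    ← Finset.add_sum_erase _ φ (Finset.mem_univ (0 : K)), hsum, ← Finset.mul_sum]
  ring

theorem fact_prime_thirteen : Fact (Nat.Prime 13) := ⟨by norm_num⟩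

attribute [local instance] fact_prime_thirteen

theorem sum_of_homogeneous {W : Type*} [AddCommGroup W] [Module (ZMod 13) W] [Fintype W]
    (h : ZMod 13 → W → ℂ) (hh : ∀ t : ZMod 13, t ≠ 0 → ∀ a w, h (t * a) (t • w) = h a w) :
    ∑ a, ∑ w, h a w = ∑ w, h 0 w + 12 * ∑ w, h 1 w := by
  have := sum_mul_of_homogeneous h hh 1
  norm_num [ZMod.card] at this
  exact this

theorem sum_pow_eq_sum_card {ι : Type*} [Fintype ι] (l : ι → ℕ) {n : ℕ} (hl : ∀ i, l i < n)
    (z : ℂ) :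
    ∑ i, z ^ l i = ∑ k : Fin n, ((Finset.univ.filter fun i => l i = k).card : ℂ) * z ^ (k : ℕ) := by
  rw [← Finset.sum_fiberwise (Finset.univ : Finset ι) (fun i => (⟨l i, hl i⟩ : Fin n))]
  refine Finset.sum_congr rfl fun k _ => ?_
  rw [← nsmul_eq_mul, ← Finset.sum_const]
  simp only [Fin.ext_iff]
  refine Finset.sum_congr rfl fun i hi => ?_
  rw [(Finset.mem_filter.mp hi).2]

theorem sum_exp_four_mul_eq_zero : ∑ a : ZMod 13,
    Complex.exp (2 * (Real.pi : ℂ) * Complex.I * ((4 * a).val : ℂ) / 13) = 0 := by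
  have h4 : (4 : ZMod 13) ≠ 0 := by decide
  refine (Equiv.sum_comp (Equiv.mulLeft₀ (4 : ZMod 13) h4) fun a : ZMod 13 =>
    Complex.exp (2 * (Real.pi : ℂ) * Complex.I * (a.val : ℂ) / 13)).trans ?_
  have hprim := Complex.isPrimitiveRoot_exp 13 (by norm_num)
  rw [← hprim.geom_sum_eq_zero (by norm_num), Finset.sum_range]
  refine Finset.sum_congr rfl fun (a : Fin 13) _ => ?_
  rw [← Complex.exp_nat_mul]
  congr 1
  push_cast
  change 2 * (Real.pi : ℂ) * Complex.I * ((a : ℕ) : ℂ) / 13 = _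
  ring

theorem natCast_finVal (a : ZMod 13) : ((Fin.val (n := 13) a : ℕ) : ZMod 13) = a :=
  ZMod.natCast_zmod_val a

section Field

variable {F : Type} [Field F] [Algebra (ZMod 13) F]

theorem charP_thirteen (F : Type) [Field F] [Algebra (ZMod 13) F] : CharP F 13 :=
  charP_of_injective_algebraMap (algebraMap (ZMod 13) F).injective 13

/-- The element `a + b α + c α² + d α³`. -/
def combine (α : F) (v : ZMod 13 × ZMod 13 × ZMod 13 × ZMod 13) : F :=
  algebraMap (ZMod 13) F v.1 + algebraMap (ZMod 13) F v.2.1 * α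
    + algebraMap (ZMod 13) F v.2.2.1 * α ^ 2 + algebraMap (ZMod 13) F v.2.2.2 * α ^ 3

theorem combine_smul (α : F) (t : ZMod 13) (v : ZMod 13 × ZMod 13 × ZMod 13 × ZMod 13) :
    combine α (t • v) = algebraMap (ZMod 13) F t * combine α v := by
  simp only [combine, Prod.smul_fst, Prod.smul_snd, smul_eq_mul, map_mul]
  ring

theorem eval_eq_combine (α : F) (x : Quad) :
    eval α x = combine α (x.1, x.2.1, x.2.2.1, x.2.2.2) := by
  simp [eval, combine]

theorem algebraMap_pow_thirteen (t : ZMod 13) :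
    algebraMap (ZMod 13) F t ^ 13 = algebraMap (ZMod 13) F t := by
  rw [← map_pow, ZMod.pow_card]

theorem natCast_pow_thirteen (n : ℕ) : (n : F) ^ 13 = n := by
  simpa using algebraMap_pow_thirteen (F := F) n

variable [Fintype F]

theorem exists_pow_four_eq_two (hcard : Fintype.card F = 13 ^ 4) : ∃ α : F, α ^ 4 = 2 := by
  have := charP_thirteen F
  have hchar : ringChar F ≠ 2 := by rw [ringChar.eq F 13]; norm_num
  have h13 : (13 : F) = 0 := by exact_mod_cast CharP.cast_eq_zero F 13
  have h2 : (2 : F) ≠ 0 := Ring.two_ne_zero hchar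
  have h12 : (2 : F) ^ 12 = 1 := by linear_combination 315 * h13
  obtain ⟨β, hβ⟩ : IsSquare (2 : F) := by
    rw [FiniteField.isSquare_iff hchar h2, hcard, show 13 ^ 4 / 2 = 12 * 1190 by norm_num,
      pow_mul, h12, one_pow]
  have hβ0 : β ≠ 0 := by rintro rfl; simp [h2] at hβ
  obtain ⟨α, rfl⟩ : IsSquare β := by
    rw [FiniteField.isSquare_iff hchar hβ0, hcard, show 13 ^ 4 / 2 = 2 * (12 * 595) by norm_num,
      pow_mul, sq, ← hβ, pow_mul, h12, one_pow]
  exact ⟨α, by rw [hβ]; ring⟩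

theorem finrank_eq_four (hcard : Fintype.card F = 13 ^ 4) : Module.finrank (ZMod 13) F = 4 := by
  have h := Module.card_eq_pow_finrank (K := ZMod 13) (V := F)
  rw [hcard, ZMod.card] at h
  exact (Nat.pow_right_injective (by norm_num : 2 ≤ 13) h).symm

theorem algebraMap_trace_eq (hcard : Fintype.card F = 13 ^ 4) (x : F) :
    algebraMap (ZMod 13) F (Algebra.trace (ZMod 13) F x) =
      x + x ^ 13 + (x ^ 13) ^ 13 + ((x ^ 13) ^ 13) ^ 13 := by
  rw [FiniteField.algebraMap_trace_eq_sum_pow, finrank_eq_four hcard]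
  simp only [Finset.sum_range_succ, Finset.sum_range_zero, Nat.card_zmod]
  ring

variable {α : F}

/-- The trace of `x α ^ k`, where `α ^ 4 = 2`. -/
theorem algebraMap_trace_mul_pow (hcard : Fintype.card F = 13 ^ 4) (hα : α ^ 4 = 2) (x : F)
    (k : ℕ) :
    algebraMap (ZMod 13) F (Algebra.trace (ZMod 13) F (x * α ^ k)) =
      (x + 8 ^ k * x ^ 13 + (-1) ^ k * (x ^ 13) ^ 13 + (-8) ^ k * ((x ^ 13) ^ 13) ^ 13) * α ^ k := by
  have := charP_thirteen F
  have h13 : (13 : F) = 0 := by exact_mod_cast CharP.cast_eq_zero F 13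
  have h8 : (8 : F) ^ 13 = 8 := by exact_mod_cast natCast_pow_thirteen (F := F) 8
  have h64 : (8 : F) * 8 = -1 := by linear_combination 5 * h13
  have hα₁ : α ^ 13 = 8 * α := by linear_combination (α ^ 9 + 2 * α ^ 5 + 4 * α) * hα
  have hα₂ : (α ^ 13) ^ 13 = -α := by
    rw [hα₁, mul_pow, h8, hα₁]
    linear_combination α * h64
  have hα₃ : ((α ^ 13) ^ 13) ^ 13 = -8 * α := by
    rw [hα₂, Odd.neg_pow (by decide), hα₁, neg_mul]
  rw [algebraMap_trace_eq hcard]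
  rw [mul_pow, mul_pow, mul_pow, pow_right_comm α k 13, pow_right_comm (α ^ 13) k 13,
    pow_right_comm ((α ^ 13) ^ 13) k 13, hα₃, hα₂, hα₁, mul_pow, mul_pow, neg_pow α]
  ring

theorem combine_surjective (hcard : Fintype.card F = 13 ^ 4) (hα : α ^ 4 = 2) :
    Function.Surjective (combine α) := by
  intro x
  have := charP_thirteen F
  have h13 : (13 : F) = 0 := by exact_mod_cast CharP.cast_eq_zero F 13
  let c (k : ℕ) := Algebra.trace (ZMod 13) F (x * α ^ k)
  refine ⟨(10 * c 0, 5 * c 3, 5 * c 2, 5 * c 1), ?_⟩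
  have h10 : algebraMap (ZMod 13) F 10 = 10 := map_ofNat _ 10
  have h5 : algebraMap (ZMod 13) F 5 = 5 := map_ofNat _ 5
  simp only [combine, map_mul, h10, h5, c, algebraMap_trace_mul_pow hcard hα]
  generalize ((x ^ 13) ^ 13) ^ 13 = x₃
  generalize (x ^ 13) ^ 13 = x₂
  generalize x ^ 13 = x₁
  have e : (10 : F) * (x + x₁ + x₂ + x₃) + 5 * 2 * (x + 8 ^ 3 * x₁ - x₂ - 8 ^ 3 * x₃)
      + 5 * 2 * (x + 8 ^ 2 * x₁ + x₂ + 8 ^ 2 * x₃) + 5 * 2 * (x + 8 * x₁ - x₂ - 8 * x₃) = x := by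
    linear_combination (3 * x + 450 * x₁ - 350 * x₃) * h13
  linear_combination e + 5 * ((x + 8 ^ 3 * x₁ - x₂ - 8 ^ 3 * x₃)
    + (x + 8 ^ 2 * x₁ + x₂ + 8 ^ 2 * x₃) + (x + 8 * x₁ - x₂ - 8 * x₃)) * hα

theorem combine_bijective (hcard : Fintype.card F = 13 ^ 4) (hα : α ^ 4 = 2) :
    Function.Bijective (combine α) := by
  rw [Fintype.bijective_iff_surjective_and_card]
  refine ⟨combine_surjective hcard hα, ?_⟩
  simp only [Fintype.card_prod, ZMod.card, hcard]
  norm_num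

theorem trace_combine (hcard : Fintype.card F = 13 ^ 4) (hα : α ^ 4 = 2)
    (v : ZMod 13 × ZMod 13 × ZMod 13 × ZMod 13) :
    Algebra.trace (ZMod 13) F (combine α v) = 4 * v.1 := by
  have := charP_thirteen F
  have h13 : (13 : F) = 0 := by exact_mod_cast CharP.cast_eq_zero F 13
  apply (algebraMap (ZMod 13) F).injective
  have h₀ := algebraMap_trace_mul_pow hcard hα (algebraMap (ZMod 13) F v.1) 0
  have h₁ := algebraMap_trace_mul_pow hcard hα (algebraMap (ZMod 13) F v.2.1) 1
  have h₂ := algebraMap_trace_mul_pow hcard hα (algebraMap (ZMod 13) F v.2.2.1) 2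
  have h₃ := algebraMap_trace_mul_pow hcard hα (algebraMap (ZMod 13) F v.2.2.2) 3
  have h4 : algebraMap (ZMod 13) F 4 = 4 := map_ofNat _ 4
  rw [pow_zero, mul_one] at h₀
  rw [pow_one] at h₁
  rw [combine, map_add, map_add, map_add, map_add, map_add, map_add, h₀, h₁, h₂, h₃, map_mul, h4]
  simp only [algebraMap_pow_thirteen]
  linear_combination 10 * algebraMap (ZMod 13) F v.2.2.1 * α ^ 2 * h13

theorem eval_gen_ne_zero (hcard : Fintype.card F = 13 ^ 4) (hα : α ^ 4 = 2) :
    eval α gen ≠ 0 := by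
  intro h
  have h0 : (0 : F) = eval α (0, 0, 0, 0) := by simp [eval]
  rw [h0, eval_eq_combine, eval_eq_combine] at h
  have := (combine_bijective hcard hα).injective h
  revert this
  decide

theorem orderOf_eval_gen (hcard : Fintype.card F = 13 ^ 4) (hα : α ^ 4 = 2) :
    orderOf (eval α gen) = 28560 := by
  have := charP_thirteen F
  have hne {p : ℕ} (hp : p ∈ [2, 3, 5, 7, 17]) : eval α gen ^ (28560 / p) ≠ 1 := by
    have hlt : 28560 / p < 2 ^ 15 := (Nat.div_le_self _ _).trans_lt (by norm_num)
    rw [← eval_pow hα _ 15 _ hlt]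
    intro h
    have h1 : (1 : F) = eval α (1, 0, 0, 0) := by simp [eval]
    rw [h1, eval_eq_combine, eval_eq_combine] at h
    have hinj := (combine_bijective hcard hα).injective h
    obtain ⟨l₀, l₁, l₂, l₃⟩ := pow_gen_lt p hp
    refine pow_gen_ne_one p hp ?_
    generalize pow gen 15 (28560 / p) = x at *
    obtain ⟨a, b, c, d⟩ := x
    simp only [Prod.mk.injEq, ZMod.natCast_eq_natCast_iff', Nat.mod_eq_of_lt l₀,
      Nat.mod_eq_of_lt l₁, Nat.mod_eq_of_lt l₂, Nat.mod_eq_of_lt l₃] at hinj ⊢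
    simpa using hinj
  have h0 := eval_gen_ne_zero hcard hα
  apply orderOf_eq_of_pow_and_pow_div_prime (by norm_num)
  · have := FiniteField.pow_card_sub_one_eq_one _ h0
    rwa [hcard] at this
  · intro p hp hdvd
    refine hne ?_
    rw [show 28560 = 2 ^ 4 * 3 * 5 * 7 * 17 by norm_num] at hdvd
    simp only [hp.dvd_mul] at hdvd
    have aux {q : ℕ} (hq : q.Prime) (h : p ∣ q) : p = q := (Nat.prime_dvd_prime_iff_eq hp hq).mp h
    rcases hdvd with (((h | h) | h) | h) | h
    · simp [aux Nat.prime_two (hp.dvd_of_dvd_pow h)]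
    all_goals simp [aux (by norm_num) h]

theorem exists_eq_gen_pow (hcard : Fintype.card F = 13 ^ 4) (hα : α ^ 4 = 2) {x : F} (hx : x ≠ 0) :
    ∃ m : ℕ, x = eval α gen ^ m := by
  have hord := orderOf_eval_gen hcard hα
  have h0 := eval_gen_ne_zero hcard hα
  have hu : orderOf (Units.mk0 _ h0) = Nat.card Fˣ := by
    rw [← orderOf_units, Units.val_mk0, hord, Nat.card_units, Nat.card_eq_fintype_card, hcard]
    norm_num
  obtain ⟨m, hm⟩ := (mem_powers_iff_mem_zpowers.mpr
    ((Subgroup.eq_top_of_card_eq (Subgroup.zpowers (Units.mk0 _ h0))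
      (by rw [Nat.card_zpowers, hu])) ▸ Subgroup.mem_top (Units.mk0 x hx)))
  exact ⟨m, by simpa using (congrArg Units.val hm).symm⟩

theorem mulChar_gen_pow_twenty (hcard : Fintype.card F = 13 ^ 4) (hα : α ^ 4 = 2)
    {χ : MulChar F ℂ} (hχ : χ ^ 20 = 1) : χ (eval α gen) ^ 20 = 1 := by
  rw [← MulChar.pow_apply' χ (by norm_num), hχ,
    MulChar.one_apply (eval_gen_ne_zero hcard hα).isUnit]

theorem mulChar_eq_pow (hcard : Fintype.card F = 13 ^ 4) (hα : α ^ 4 = 2) {χ : MulChar F ℂ}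
    (hχ : χ ^ 20 = 1) {x : F} (k : ℕ) (hxk : x ^ 1428 = eval α gen ^ (1428 * k)) :
    χ x = χ (eval α gen) ^ k := by
  have hord := orderOf_eval_gen hcard hα
  have hg := eval_gen_ne_zero hcard hα
  have hx : x ≠ 0 := by
    rintro rfl
    exact pow_ne_zero (1428 * k) hg (by rw [← hxk]; simp)
  obtain ⟨m, rfl⟩ := exists_eq_gen_pow hcard hα hx
  have hζ := mulChar_gen_pow_twenty hcard hα hχ
  rw [← pow_mul, (isOfFinOrder_iff_pow_eq_one.mpr ⟨28560, by norm_num,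
    hord ▸ pow_orderOf_eq_one _⟩).pow_eq_pow_iff_modEq, hord, mul_comm] at hxk
  have hmk : m ≡ k [MOD 20] :=
    Nat.ModEq.mul_left_cancel' (c := 1428) (by norm_num) (by simpa using hxk)
  rw [map_pow, pow_eq_pow_mod m hζ, pow_eq_pow_mod k hζ, hmk]

theorem mulChar_algebraMap (hcard : Fintype.card F = 13 ^ 4) {χ : MulChar F ℂ} (hχ : χ ^ 20 = 1)
    {t : ZMod 13} (ht : t ≠ 0) : χ (algebraMap (ZMod 13) F t) = 1 := by
  obtain ⟨α, hα⟩ := exists_pow_four_eq_two hcard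
  rw [mulChar_eq_pow hcard hα hχ 0, pow_zero]
  have h : t ^ 1428 = 1 := by
    rw [show 1428 = (13 - 1) * 119 by norm_num, pow_mul, ZMod.pow_card_sub_one_eq_one ht, one_pow]
  rw [← map_pow, h, map_one, mul_zero, pow_zero]

theorem mulChar_eval (hcard : Fintype.card F = 13 ^ 4) (hα : α ^ 4 = 2) {χ : MulChar F ℂ}
    (hχ : χ ^ 20 = 1) (x : Quad) {k : ℕ} (hk : k < 20) (h : pow x 11 1428 = pow unit20 5 k) :
    χ (eval α x) = χ (eval α gen) ^ k := by
  have := charP_thirteen F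
  refine mulChar_eq_pow hcard hα hχ k ?_
  rw [← eval_pow hα x 11 _ (by norm_num), h, eval_pow hα _ _ _ (by omega), ← pow_gen,
    eval_pow hα _ _ _ (by norm_num), pow_mul]

/-- The sum of a character of order `20` over the hyperplane of elements of trace zero. -/
theorem sum_mulChar_trace_zero (hcard : Fintype.card F = 13 ^ 4) (hα : α ^ 4 = 2)
    {χ : MulChar F ℂ} (hχ : χ ^ 20 = 1) (hζ : χ (eval α gen) ^ 4 ≠ 1) :
    ∑ w : ZMod 13 × ZMod 13 × ZMod 13, χ (combine α (0, w)) = 12 * 13 * χ (eval α gen) ^ 15 := by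
  have hhom (t : ZMod 13) (ht : t ≠ 0) (v : ZMod 13 × ZMod 13 × ZMod 13 × ZMod 13) :
      χ (combine α (t • v)) = χ (combine α v) := by
    rw [combine_smul, map_mul, mulChar_algebraMap hcard hχ ht, one_mul]
  have hζ20 := mulChar_gen_pow_twenty hcard hα hχ
  have e₁ (x : ZMod 13 × ZMod 13) :
      χ (combine α (0, 1, x)) = χ (eval α gen) ^ log₁ x := by
    rw [← mulChar_eval hcard hα hχ _ (log₁_lt x) (pow_log₁ x), eval_eq_combine]
    simp [natCast_finVal]
  have e₂ (d : ZMod 13) : χ (combine α (0, 0, 1, d)) = χ (eval α gen) ^ log₂ d := by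
    rw [← mulChar_eval hcard hα hχ _ (log₂_lt d) (pow_log₂ d), eval_eq_combine]
    simp [natCast_finVal]
  have e₃ : χ (combine α (0, 0, 0, 1)) = χ (eval α gen) ^ 5 := by
    rw [← mulChar_eval hcard hα hχ _ (by norm_num) pow_log₃, eval_eq_combine]
    simp
  have e₀ : χ (combine α (0, 0, 0, 0)) = 0 := by
    rw [combine]
    simpa using χ.map_zero
  have s₁ : ∑ x : ZMod 13 × ZMod 13, χ (combine α (0, 1, x)) = _ :=
    (Finset.sum_congr rfl fun x _ => e₁ x).trans (sum_pow_eq_sum_card log₁ log₁_lt _)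
  have s₂ : ∑ d : ZMod 13, χ (combine α (0, 0, 1, d)) = _ :=
    (Finset.sum_congr rfl fun d _ => e₂ d).trans (sum_pow_eq_sum_card log₂ log₂_lt _)
  simp only [card_log₁] at s₁
  simp only [card_log₂] at s₂
  have h₁ := sum_of_homogeneous (fun b (x : ZMod 13 × ZMod 13) => χ (combine α (0, b, x)))
    fun t ht b x => by simpa using hhom t ht (0, b, x)
  have h₂ := sum_of_homogeneous (fun c (d : ZMod 13) => χ (combine α (0, 0, c, d)))
    fun t ht c d => by simpa using hhom t ht (0, 0, c, d)
  have h₃ := sum_of_homogeneous (fun d (_ : Unit) => χ (combine α (0, 0, 0, d)))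
    fun t ht d _ => by simpa using hhom t ht (0, 0, 0, d)
  simp only [Fintype.sum_prod_type] at h₁ h₂ h₃ s₁ ⊢
  simp only [Finset.univ_unique, Finset.sum_singleton, e₀, e₃] at h₃
  rw [h₁, h₂, h₃, s₁, s₂]
  generalize χ (eval α gen) = ζ at *
  have hcyc : 1 + ζ ^ 4 + ζ ^ 8 + ζ ^ 12 + ζ ^ 16 = 0 :=
    (mul_eq_zero.mp (by linear_combination hζ20 :
      (ζ ^ 4 - 1) * (1 + ζ ^ 4 + ζ ^ 8 + ζ ^ 12 + ζ ^ 16) = 0)).resolve_left (sub_ne_zero.mpr hζ)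
  simp [Fin.sum_univ_succ, List.getD]
  linear_combination 12 * (8 + 11 * ζ + 9 * ζ ^ 2 + 6 * ζ ^ 3) * hcyc

end Field

end GaussSumCard28561

open GaussSumCard28561 Quad in
/-- **Evaluation of Gauss sums of order 20 over `F_{13⁴}`.**
For every multiplicative character `χ` of order `20` of the finite field `F` with
`13⁴ = 28561` elements, the Gauss sum
`G(χ) = ∑ x, χ x · exp(2πi·T(x)/13)` (where `T` is the trace to `F_13`, lifted to `ℕ`
via `ZMod.val`) equals `±13²·i = ±169·i`. -/
theorem gauss_sum_order_twenty_card_13_pow_4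
    (F : Type) [Field F] [Fintype F] [Algebra (ZMod 13) F]
    (hcard : Fintype.card F = 13 ^ 4)
    (χ : MulChar F ℂ) (hχ : orderOf χ = 20) :
    (∑ x : F, χ x * Complex.exp (2 * (Real.pi : ℂ) * Complex.I *
        ((Algebra.trace (ZMod 13) F x).val : ℂ) / 13)) = 169 * Complex.I ∨
    (∑ x : F, χ x * Complex.exp (2 * (Real.pi : ℂ) * Complex.I *
        ((Algebra.trace (ZMod 13) F x).val : ℂ) / 13)) = -(169 * Complex.I) := by
  have := fact_prime_thirteen
  obtain ⟨α, hα⟩ := exists_pow_four_eq_two hcard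
  have hχ20 : χ ^ 20 = 1 := hχ ▸ pow_orderOf_eq_one χ
  have hpow (n : ℕ) (hn : 0 < n) (hn' : n < 20) : χ (eval α gen) ^ n ≠ 1 := by
    intro h
    refine pow_ne_one_of_lt_orderOf hn.ne' (hχ ▸ hn') (MulChar.ext' fun x => ?_)
    by_cases hx : x = 0
    · rw [hx, MulChar.map_zero, MulChar.map_zero]
    obtain ⟨m, rfl⟩ := exists_eq_gen_pow hcard hα hx
    rw [MulChar.pow_apply' χ hn.ne', map_pow, ← pow_mul, mul_comm, pow_mul, h, one_pow,
      MulChar.one_apply (Ne.isUnit hx)]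
  set ζ := χ (eval α gen)
  have hsum : ∑ w : ZMod 13 × ZMod 13 × ZMod 13, χ (combine α (0, w)) = 12 * 13 * ζ ^ 15 :=
    sum_mulChar_trace_zero hcard hα hχ20 (hpow 4 (by norm_num) (by norm_num))
  have hζ20 : ζ ^ 20 = 1 := mulChar_gen_pow_twenty hcard hα hχ20
  have hζ5 : ζ ^ 15 = Complex.I ∨ ζ ^ 15 = -Complex.I := by
    have hζ10 : ζ ^ 10 = -1 := by
      have : (ζ ^ 10 - 1) * (ζ ^ 10 + 1) = 0 := by linear_combination hζ20
      exact eq_neg_of_add_eq_zero_left ((mul_eq_zero.mp this).resolve_left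
        (sub_ne_zero.mpr (hpow 10 (by norm_num) (by norm_num))))
    rw [← sq_eq_sq_iff_eq_or_eq_neg, Complex.I_sq, ← pow_mul]
    linear_combination ζ ^ 20 * hζ10 - hζ20
  have hhom (t : ZMod 13) (ht : t ≠ 0) (a : ZMod 13) (w : ZMod 13 × ZMod 13 × ZMod 13) :
      χ (combine α (t * a, t • w)) = χ (combine α (a, w)) := by
    have := combine_smul α t (a, w)
    rw [Prod.smul_mk, smul_eq_mul] at this
    rw [this, map_mul, mulChar_algebraMap hcard hχ20 ht, one_mul]
  let φ (a : ZMod 13) : ℂ :=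
    Complex.exp (2 * (Real.pi : ℂ) * Complex.I * ((4 * a).val : ℂ) / 13)
  have hφ : ∑ a, φ a = 0 := sum_exp_four_mul_eq_zero
  have hφ0 : φ 0 = 1 := by simp [φ]
  have htotal : ∑ a : ZMod 13, ∑ w : ZMod 13 × ZMod 13 × ZMod 13, χ (combine α (a, w)) = 0 := by
    rw [← Fintype.sum_prod_type', (combine_bijective hcard hα).sum_comp χ]
    exact MulChar.sum_eq_zero_of_ne_one fun h => by simp [h] at hχ
  have hgauss : ∑ x : F, χ x * Complex.exp (2 * (Real.pi : ℂ) * Complex.I *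
      ((Algebra.trace (ZMod 13) F x).val : ℂ) / 13) = 169 * ζ ^ 15 := by
    rw [← (combine_bijective hcard hα).sum_comp, Fintype.sum_prod_type]
    simp only [trace_combine hcard hα]
    rw [sum_mul_of_homogeneous (fun a w => χ (combine α (a, w))) hhom φ, hφ, hφ0]
    rw [sum_of_homogeneous (fun a w => χ (combine α (a, w))) hhom] at htotal
    linear_combination 13 / 12 * hsum - 1 / 12 * htotal
  rw [hgauss]
  rcases hζ5 with h | h <;> simp [h]
end

section
/- For every multiplicative character χ of order 28 of the finite field F_q with q = 11^6 = 1771561, the Gauss sum G(χ) = Σ_{x ∈ F_q} χ(x) ψ(x) ∈ ℂ equals −11³ = −1331. -/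
/-- A multiplicative character of exponent `N` is trivial on the `m`-torsion when `N * m` divides
the order of the multiplicative group. -/
lemma MulChar.apply_eq_one_of_pow_eq_one {F : Type*} [Field F] [Fintype F] {χ : MulChar F ℂ}
    {N m : ℕ} (hχ : χ ^ N = 1) (hm : 0 < m) (hdvd : N * m ∣ Fintype.card F - 1) {a : F}
    (ha : a ^ m = 1) : χ a = 1 := by
  have ha0 : a ≠ 0 := by
    rintro rfl
    simp [hm.ne'] at ha
  obtain ⟨g, hg⟩ := IsCyclic.exists_monoid_generator (α := Fˣ)
  obtain ⟨k, hk⟩ := hg (Units.mk0 a ha0)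
  have hk : g ^ k = Units.mk0 a ha0 := hk
  have hkm : g ^ (k * m) = 1 := by
    rw [pow_mul, hk]
    ext
    simpa using ha
  have hord : orderOf g = Fintype.card F - 1 := by
    rw [orderOf_eq_card_of_forall_mem_powers hg, Nat.card_units, Nat.card_eq_fintype_card]
  have hN : N ∣ k := by
    have := hdvd.trans (hord ▸ orderOf_dvd_of_pow_eq_one hkm)
    exact Nat.dvd_of_mul_dvd_mul_right hm this
  obtain ⟨l, rfl⟩ := hN
  have hal : a = ((g ^ l : Fˣ) : F) ^ N := by
    rw [← Units.val_pow_eq_pow_val, ← pow_mul, mul_comm l, hk, Units.val_mk0]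
  rw [hal, map_pow, ← MulChar.pow_apply_coe, hχ, MulChar.one_apply_coe]

/-- The Jacobi sum form of the duplication formula. -/
lemma apply_four_mul_jacobiSum_self {F : Type*} [Field F] [Fintype F] [DecidableEq F]
    (hF : ringChar F ≠ 2) {χ : MulChar F ℂ} (hχ : χ ≠ 1) :
    χ 4 * jacobiSum χ χ =
      jacobiSum χ ((quadraticChar F).ringHomComp (Int.castRingHom ℂ)) := by
  have h2 : (2 : F) ≠ 0 := Ring.two_ne_zero hF
  have hsub : ∑ x : F, χ (1 - x) = 0 := by
    rw [← MulChar.sum_eq_zero_of_ne_one hχ]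
    exact (Equiv.subLeft (1 : F)).sum_comp χ
  calc χ 4 * jacobiSum χ χ = ∑ x : F, χ (1 - (1 - 2 * x) ^ 2) := by
        rw [jacobiSum, Finset.mul_sum]
        refine Finset.sum_congr rfl fun x _ ↦ ?_
        rw [← map_mul, ← map_mul]
        ring_nf
    _ = ∑ y : F, χ (1 - y ^ 2) :=
        ((Equiv.mulLeft₀ 2 h2).trans (Equiv.subLeft 1)).sum_comp fun y ↦ χ (1 - y ^ 2)
    _ = ∑ u : F, ∑ y : F with y ^ 2 = u, χ (1 - y ^ 2) :=
        (Finset.sum_fiberwise _ _ _).symm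
    _ = ∑ u : F, ((quadraticChar F u : ℂ) + 1) * χ (1 - u) := by
        refine Finset.sum_congr rfl fun u _ ↦ ?_
        have hcard := quadraticChar_card_sqrts hF u
        rw [Set.toFinset_ofPred] at hcard
        have hcard' : ((Finset.univ.filter fun y : F ↦ y ^ 2 = u).card : ℂ) =
            quadraticChar F u + 1 := by exact_mod_cast hcard
        rw [← hcard', ← nsmul_eq_mul]
        refine Finset.sum_eq_card_nsmul fun y hy ↦ ?_
        rw [(Finset.mem_filter.mp hy).2]
    _ = _ := by
        simp only [add_mul, one_mul, Finset.sum_add_distrib, hsub, add_zero]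
        rw [jacobiSum_comm, jacobiSum]
        rfl

/-- The duplication formula for Gauss sums. -/
lemma apply_four_mul_gaussSum_mul_gaussSum {F : Type*} [Field F] [Fintype F] [DecidableEq F]
    (hF : ringChar F ≠ 2) {χ η : MulChar F ℂ} (hχ : χ ≠ 1) (hχ2 : χ ^ 2 ≠ 1)
    (hη : η = (quadraticChar F).ringHomComp (Int.castRingHom ℂ)) (hχη : χ * η ≠ 1)
    {ψ : AddChar F ℂ} (hψ : ψ.IsPrimitive) :
    χ 4 * (gaussSum χ ψ * gaussSum (χ * η) ψ) = gaussSum (χ ^ 2) ψ * gaussSum η ψ := by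
  have h1 := jacobiSum_mul_nontrivial (pow_two χ ▸ hχ2) ψ
  have h2 := jacobiSum_mul_nontrivial hχη ψ
  have hJ := apply_four_mul_jacobiSum_self hF hχ
  rw [← hη] at hJ
  rw [← hJ] at h2
  rw [← pow_two χ] at h1
  have h0 : gaussSum χ ψ ≠ 0 :=
    gaussSum_ne_zero_of_nontrivial (Nat.cast_ne_zero.mpr Fintype.card_ne_zero) hχ hψ
  refine mul_left_cancel₀ h0 ?_
  linear_combination (-χ 4 * gaussSum (χ * η) ψ) * h1 + gaussSum (χ ^ 2) ψ * h2

/-- The nontrivial quadratic character with values in `ℂ` is unique. -/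
lemma MulChar.eq_quadraticChar_of_sq_eq_one {F : Type*} [Field F] [Fintype F] [DecidableEq F]
    (hF : ringChar F ≠ 2) {η : MulChar F ℂ} (hη : η ≠ 1) (hη2 : η ^ 2 = 1) :
    η = (quadraticChar F).ringHomComp (Int.castRingHom ℂ) := by
  obtain ⟨g, hg⟩ := IsCyclic.exists_generator (α := Fˣ)
  have key : ∀ φ : MulChar F ℂ, φ ≠ 1 → φ ^ 2 = 1 → φ g = -1 := by
    intro φ hφ hφ2
    have h1 : φ g ^ 2 = 1 := by rw [← MulChar.pow_apply_coe, hφ2, MulChar.one_apply_coe]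
    refine (sq_eq_one_iff.mp h1).resolve_left ?_
    intro h
    exact hφ ((MulChar.eq_iff hg φ 1).mpr (by rw [h, MulChar.one_apply_coe]))
  rw [MulChar.eq_iff hg, key η hη hη2, key _ ?_ ?_]
  · exact (MulChar.ringHomComp_ne_one_iff Int.cast_injective).mpr (quadraticChar_ne_one hF)
  · exact ((quadraticChar_isQuadratic F).comp _).sq_eq_one

/-- The Gauss sum of a character trivial on the fixed field of an involution. -/
lemma gaussSum_eq_card_mul_of_trivial_on_fixedField {F : Type*} [Field F] [Fintype F]
    (h2 : (2 : F) ≠ 0) {σ : F →+* F} (hσ : ∀ x, σ (σ x) = x) {χ : MulChar F ℂ} (hχ : χ ≠ 1)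
    (hχσ : ∀ x, σ x = x → x ≠ 0 → χ x = 1) {ψ : AddChar F ℂ} (hψ : ψ ≠ 1)
    (hψσ : ∀ x, ψ (σ x) = ψ x) {c : F} (hc0 : c ≠ 0) (hc : σ c = -c) {q : ℕ}
    (hq : Fintype.card F = q ^ 2) :
    gaussSum χ ψ = q * χ c := by
  classical
  let K : Subfield F := σ.eqLocusField (RingHom.id F)
  have hK : ∀ x : K, σ x = x := fun x ↦ x.2
  have hσ2 : σ 2 = 2 := map_ofNat σ 2
  let e : K × K ≃ F :=
    { toFun := fun p ↦ p.1 + c * p.2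
      invFun := fun x ↦ (⟨(x + σ x) / 2, by
          change σ _ = _
          simp [hσ, hσ2, add_comm]⟩, ⟨(x - σ x) / (2 * c), by
          change σ _ = _
          simp only [map_div₀, map_sub, map_mul, hσ, hσ2, hc, RingHom.id_apply]
          field_simp
          ring⟩)
      left_inv := by
        rintro ⟨a, b⟩
        ext
        · simp only [map_add, map_mul, hK, hc]
          field_simp
          ring
        · simp only [map_add, map_mul, hK, hc]
          field_simp
          ring
      right_inv := by
        intro x
        dsimp only
        field_simp
        ring }
  have hcardK : Fintype.card K = q := by
    have := Fintype.card_congr e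
    rw [Fintype.card_prod, hq, ← pow_two] at this
    exact Nat.pow_left_injective two_ne_zero this
  have hψc : ∀ b : K, ψ (c * b) = 1 := by
    intro b
    have hb : c * (b : F) = c * b / 2 + -σ (c * b / 2) := by
      simp only [map_div₀, map_mul, hK, hc, hσ2]
      field_simp
      ring
    rw [hb, AddChar.map_add_eq_mul, AddChar.map_neg_eq_inv, hψσ, mul_inv_cancel₀]
    exact (ψ.val_isUnit _).ne_zero
  have hψK : ∑ a : K, ψ a = 0 := by
    let ψK : AddChar K ℂ := ψ.compAddMonoidHom K.subtype.toAddMonoidHom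
    have hne : ψK ≠ 1 := by
      obtain ⟨y, hy⟩ := AddChar.ne_one_iff.mp hψ
      refine AddChar.ne_one_iff.mpr ⟨(e.symm y).1, ?_⟩
      have : ψ y = ψ ((e.symm y).1 : F) := by
        conv_lhs => rw [← e.apply_symm_apply y]
        change ψ (_ + c * _) = _
        rw [AddChar.map_add_eq_mul, hψc, mul_one]
      exact this ▸ hy
    exact AddChar.sum_eq_zero_of_ne_one hne
  have hχK : ∀ a : K, a ≠ 0 → χ a = 1 := fun a ha ↦ hχσ a (hK a) (by simpa using ha)
  set S : ℂ := ∑ b : K, χ (1 + c * b)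
  have hrow : ∀ a : K, a ≠ 0 → ∑ b : K, χ (a + c * b) = S := by
    intro a ha
    rw [← Equiv.sum_comp (Equiv.mulLeft₀ a ha) fun b : K ↦ χ (a + c * b)]
    refine Finset.sum_congr rfl fun b _ ↦ ?_
    have : (a : F) + c * ((Equiv.mulLeft₀ a ha) b : K) = a * (1 + c * b) := by
      simp
      ring
    rw [this, map_mul, hχK a ha, one_mul]
  have hrow0 : ∑ b : K, χ ((0 : K) + c * b) = (q - 1) * χ c := by
    rw [← Finset.add_sum_erase _ _ (Finset.mem_univ (0 : K))]
    have : ∀ b ∈ Finset.univ.erase (0 : K), χ ((0 : K) + c * b) = χ c := by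
      intro b hb
      rw [ZeroMemClass.coe_zero, zero_add, map_mul, hχK b (Finset.ne_of_mem_erase hb), mul_one]
    rw [Finset.sum_congr rfl this, Finset.sum_const, Finset.card_erase_of_mem (Finset.mem_univ _),
      Finset.card_univ, hcardK, nsmul_eq_mul, Nat.cast_sub (hcardK ▸ Fintype.card_pos)]
    simp [χ.map_zero]
  have hweight : ∀ w : K → ℂ, ∑ a : K, w a * ∑ b : K, χ (a + c * b) =
      w 0 * ((q - 1) * χ c) + (∑ a : K, w a - w 0) * S := by
    intro w
    rw [← Finset.add_sum_erase _ _ (Finset.mem_univ (0 : K)), hrow0,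
      ← Finset.sum_erase_eq_sub (Finset.mem_univ (0 : K)), Finset.sum_mul]
    congr 1
    refine Finset.sum_congr rfl fun a ha ↦ ?_
    rw [hrow a (Finset.ne_of_mem_erase ha)]
  have hsum : ∑ a : K, (1 : ℂ) * ∑ b : K, χ (a + c * b) = 0 := by
    rw [← MulChar.sum_eq_zero_of_ne_one hχ, ← e.sum_comp, Fintype.sum_prod_type]
    simp only [one_mul]
    rfl
  have hgauss : ∑ a : K, ψ a * ∑ b : K, χ (a + c * b) = gaussSum χ ψ := by
    rw [gaussSum, ← e.sum_comp, Fintype.sum_prod_type]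
    refine Finset.sum_congr rfl fun a _ ↦ ?_
    rw [Finset.mul_sum]
    refine Finset.sum_congr rfl fun b _ ↦ ?_
    change _ = χ (a + c * b) * ψ (a + c * b)
    rw [AddChar.map_add_eq_mul, hψc, mul_one, mul_comm]
  rw [hweight fun _ ↦ 1] at hsum
  rw [hweight fun a ↦ ψ a, hψK] at hgauss
  simp only [Finset.sum_const, Finset.card_univ, hcardK, nsmul_eq_mul, mul_one, one_mul] at hsum
  simp only [ZeroMemClass.coe_zero, AddChar.map_zero_eq_one] at hgauss
  have hq1 : (q : ℂ) - 1 ≠ 0 := by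
    rw [sub_ne_zero, Ne, Nat.cast_eq_one]
    exact hcardK ▸ Fintype.one_lt_card.ne'
  have hS : χ c + S = 0 := by
    refine mul_left_cancel₀ hq1 ?_
    linear_combination hsum
  linear_combination -hgauss - hS

/-- The Frobenius congruence for finite sums. -/
lemma exists_sum_pow_prime_eq {ι A : Type*} [CommRing A] {p : ℕ} (hp : p.Prime) (s : Finset ι)
    (f : ι → A) : ∃ r, (∑ i ∈ s, f i) ^ p = ∑ i ∈ s, f i ^ p + p * r := by
  classical
  induction s using Finset.induction_on with
  | empty => exact ⟨0, by simp [hp.ne_zero]⟩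
  | insert a s ha ih =>
    obtain ⟨r, hr⟩ := ih
    obtain ⟨t, ht⟩ := exists_add_pow_prime_eq hp (f a) (∑ i ∈ s, f i)
    refine ⟨r + f a * (∑ i ∈ s, f i) * t, ?_⟩
    rw [Finset.sum_insert ha, Finset.sum_insert ha, ht, hr]
    ring

/-- The `p`-th power of a Gauss sum is congruent to the Gauss sum of the `p`-th powers modulo `p`
in the ring of algebraic integers. -/
lemma exists_isIntegral_gaussSum_pow_eq {F : Type*} [Field F] [Fintype F] (χ : MulChar F ℂ)
    (ψ : AddChar F ℂ) {p : ℕ} (hp : p.Prime) :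
    ∃ r : ℂ, IsIntegral ℤ r ∧ gaussSum χ ψ ^ p = gaussSum (χ ^ p) (ψ ^ p) + p * r := by
  have h_integral : ∀ x : F, IsIntegral ℤ (χ x * ψ x) := by
    intro x
    refine IsIntegral.mul ?_ ?_
    · rcases eq_or_ne x 0 with rfl | hx
      · rw [χ.map_zero]
        exact isIntegral_zero
      · refine IsIntegral.of_pow (n := Fintype.card F - 1) (Nat.sub_pos_of_lt Fintype.one_lt_card) ?_
        rw [← map_pow, FiniteField.pow_card_sub_one_eq_one x hx, map_one]
        exact isIntegral_one
    · refine IsIntegral.of_pow (n := Fintype.card F) Fintype.card_pos ?_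
      rw [← AddChar.map_nsmul_eq_pow, card_nsmul_eq_zero, AddChar.map_zero_eq_one]
      exact isIntegral_one
  obtain ⟨r, hr⟩ := exists_sum_pow_prime_eq hp Finset.univ
    fun x : F ↦ (⟨χ x * ψ x, h_integral x⟩ : integralClosure ℤ ℂ)
  refine ⟨r, r.2, ?_⟩
  have := congrArg (Subtype.val) hr
  push_cast at this
  rw [gaussSum, gaussSum, this]
  congr 1
  refine Finset.sum_congr rfl fun x _ ↦ ?_
  rw [mul_pow, MulChar.pow_apply' _ hp.ne_zero, AddChar.pow_apply]

/-- Gauss sums do not change when the multiplicative character is composed with a power map that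
is a bijection fixing the additive character. -/
lemma gaussSum_pow_of_invariant {F : Type*} [Field F] [Fintype F] (χ : MulChar F ℂ)
    {ψ : AddChar F ℂ} {n : ℕ} (hn : n ≠ 0) {σ : F ≃ F} (hσ : ∀ x, σ x = x ^ n)
    (hψ : ∀ x, ψ (σ x) = ψ x) : gaussSum (χ ^ n) ψ = gaussSum χ ψ := by
  rw [gaussSum, gaussSum, ← σ.sum_comp fun x ↦ χ x * ψ x]
  refine Finset.sum_congr rfl fun x _ ↦ ?_
  rw [hψ, hσ, map_pow, MulChar.pow_apply' _ hn]

/-- An integer congruence seen in the ring of algebraic integers. -/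
lemma Int.dvd_of_isIntegral {n m : ℤ} (hn : n ≠ 0) {r : ℂ} (hr : IsIntegral ℤ r)
    (h : (m : ℂ) = n * r) : n ∣ m := by
  have hn' : (n : ℂ) ≠ 0 := Int.cast_ne_zero.mpr hn
  have hrq : r = algebraMap ℚ ℂ (m / n) := by
    rw [map_div₀, map_intCast, map_intCast, h]
    field_simp
  have hq : IsIntegral ℤ ((m : ℚ) / n) :=
    (isIntegral_algebraMap_iff (algebraMap ℚ ℂ).injective).mp (hrq ▸ hr)
  obtain ⟨y, hy⟩ := IsIntegrallyClosed.isIntegral_iff.mp hq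
  refine ⟨y, ?_⟩
  have hn'' : (n : ℚ) ≠ 0 := Int.cast_ne_zero.mpr hn
  have : (m : ℚ) = n * y := by
    rw [eq_intCast] at hy
    rw [hy]
    field_simp
  exact_mod_cast this

/-- **Evaluation of Gauss sums of order 28 over `F_{11⁶}`.**
For every multiplicative character `χ` of order `28` of the finite field `F` with
`11⁶ = 1771561` elements, the Gauss sum
`G(χ) = ∑ x, χ x · exp(2πi·T(x)/11)` equals `−11³ = −1331`. -/
theorem gauss_sum_order_28_card_11_pow_6
    (F : Type) [Field F] [Fintype F] [Algebra (ZMod 11) F]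
    (hcard : Fintype.card F = 11 ^ 6)
    (χ : MulChar F ℂ) (hχ : orderOf χ = 28) :
    (∑ x : F, χ x * Complex.exp (2 * (Real.pi : ℂ) * Complex.I *
        ((Algebra.trace (ZMod 11) F x).val : ℂ) / 11)) = -(1331 : ℂ) := by
  classical
  have : Fact (Nat.Prime 11) := ⟨by norm_num⟩
  have : CharP F 11 := charP_of_injective_algebraMap (algebraMap (ZMod 11) F).injective 11
  have hrc : ringChar F ≠ 2 := by
    rw [ringChar.eq F 11]
    norm_num
  have h2 : (2 : F) ≠ 0 := Ring.two_ne_zero hrc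
  let ψ : AddChar F ℂ :=
    (ZMod.stdAddChar (N := 11)).compAddMonoidHom (Algebra.trace (ZMod 11) F).toAddMonoidHom
  have hψapply : ∀ x, ψ x = Complex.exp (2 * (Real.pi : ℂ) * Complex.I *
      ((Algebra.trace (ZMod 11) F x).val : ℂ) / 11) := by
    intro x
    change ZMod.stdAddChar (Algebra.trace (ZMod 11) F x) = _
    rw [ZMod.stdAddChar_apply, ZMod.toCircle_apply]
    norm_num
  have hψ1 : ψ ≠ 1 := by
    obtain ⟨x, hx⟩ := Algebra.trace_surjective (ZMod 11) F 1
    refine AddChar.ne_one_iff.mpr ⟨x, ?_⟩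
    change ZMod.stdAddChar (Algebra.trace (ZMod 11) F x) ≠ 1
    rw [hx, ← AddChar.map_zero_eq_one (ZMod.stdAddChar (N := 11))]
    exact ZMod.injective_stdAddChar.ne one_ne_zero
  have hψ : ψ.IsPrimitive := .of_ne_one hψ1
  have hψfrob : ∀ x, ψ (x ^ 11) = ψ x := by
    intro x
    have := Algebra.trace_eq_of_algEquiv (FiniteField.frobeniusAlgEquiv (ZMod 11) F 11) x
    rw [FiniteField.frobeniusAlgEquiv_apply, ZMod.card] at this
    rw [hψapply, hψapply, this]
  have hG : ∀ φ : MulChar F ℂ, gaussSum (φ ^ 11) ψ = gaussSum φ ψ := fun φ ↦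
    gaussSum_pow_of_invariant φ (by norm_num) (σ := (frobeniusEquiv F 11).toEquiv)
      (fun _ ↦ rfl) hψfrob
  simp only [← hψapply]
  change gaussSum χ ψ = _
  have hpow : χ ^ 28 = 1 := hχ ▸ pow_orderOf_eq_one χ
  have hne : ∀ k, ¬ 28 ∣ k → χ ^ k ≠ 1 := fun k hk h ↦ hk (hχ ▸ orderOf_dvd_of_pow_eq_one h)
  have htorsion : ∀ a : F, a ^ 10 = 1 → χ a = 1 := fun a ha ↦
    MulChar.apply_eq_one_of_pow_eq_one hpow (m := 10) (by norm_num) (by rw [hcard]; norm_num) ha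
  have hnat : ∀ n : ℕ, n ^ 10 ≡ 1 [MOD 11] → χ n = 1 := fun n hn ↦
    htorsion n (by exact_mod_cast (CharP.natCast_eq_natCast F 11).mpr hn)
  have hχ4 : χ 4 = 1 := hnat 4 (by decide)
  have hη : χ ^ 14 = (quadraticChar F).ringHomComp (Int.castRingHom ℂ) := by
    refine MulChar.eq_quadraticChar_of_sq_eq_one hrc (hne 14 (by norm_num)) ?_
    rw [← pow_mul, hpow]
  -- The square of the Gauss sum.
  have hsq : gaussSum χ ψ ^ 2 = 1331 ^ 2 := by
    have hA := apply_four_mul_gaussSum_mul_gaussSum hrc (pow_one χ ▸ hne 1 (by norm_num))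
      (hne 2 (by norm_num)) hη (by rw [← pow_succ']; exact hne 15 (by norm_num)) hψ
    have hB := apply_four_mul_gaussSum_mul_gaussSum hrc (hne 16 (by norm_num))
      (by rw [← pow_mul]; exact hne 32 (by norm_num)) hη
      (by rw [← pow_add]; exact hne 30 (by norm_num)) hψ
    have e15 : gaussSum (χ * χ ^ 14) ψ = gaussSum χ ψ := by
      rw [← hG χ, ← hG (χ ^ 11), ← hG ((χ ^ 11) ^ 11), ← pow_mul, ← pow_mul, ← pow_succ' χ 14,
        show 11 * 11 * 11 = 28 * 47 + 15 by norm_num, pow_add χ (28 * 47), pow_mul χ 28, hpow, one_pow, one_mul]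
    have e32 : gaussSum ((χ ^ 16) ^ 2) ψ = gaussSum (χ ^ 16) ψ := by
      rw [← hG (χ ^ 16), ← hG ((χ ^ 16) ^ 11), ← pow_mul, ← pow_mul, ← pow_mul,
        show 16 * 11 * 11 = 28 * 68 + 16 * 2 by norm_num, pow_add, pow_mul χ 28, hpow, one_pow,
        one_mul]
    have e30 : χ ^ 16 * χ ^ 14 = χ ^ 2 := by
      rw [← pow_add, show 16 + 14 = 28 + 2 by norm_num, pow_add, hpow, one_mul]
    have h16 : (χ ^ 16) 4 = 1 := by
      rw [MulChar.pow_apply' _ (by norm_num), hχ4, one_pow]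
    have h0 : gaussSum (χ ^ 16) ψ ≠ 0 :=
      gaussSum_ne_zero_of_nontrivial (Nat.cast_ne_zero.mpr Fintype.card_ne_zero)
        (hne 16 (by norm_num)) hψ
    rw [hχ4, e15, one_mul] at hA
    rw [h16, e30, e32, one_mul] at hB
    have hquad := gaussSum_sq (hne 14 (by norm_num)) (hη ▸ (quadraticChar_isQuadratic F).comp _) hψ
    have hneg : (χ ^ 14) (-1) = 1 := by
      rw [MulChar.pow_apply' _ (by norm_num), htorsion (-1) (by norm_num), one_pow]
    rw [hneg, hcard] at hquad
    rw [pow_two, hA, mul_left_cancel₀ h0 hB, ← pow_two, hquad]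
    norm_num
  -- The Gauss sum of the quartic power.
  have hquartic : gaussSum (χ ^ 7) ψ = -1331 := by
    obtain ⟨g, hg⟩ := IsCyclic.exists_generator (α := Fˣ)
    have hord : orderOf g = 11 ^ 6 - 1 := by
      rw [orderOf_eq_card_of_forall_mem_zpowers hg, Nat.card_units, Nat.card_eq_fintype_card, hcard]
    have hord2 : g ^ 885780 = -1 := by
      have h1 : (g ^ 885780) ^ 2 = 1 := by
        rw [← pow_mul]
        exact orderOf_dvd_iff_pow_eq_one.mp (by rw [hord]; norm_num)
      have h3 : g ^ 885780 ≠ 1 := fun h ↦ by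
        have := orderOf_dvd_of_pow_eq_one h
        rw [hord] at this
        norm_num at this
      ext
      refine (sq_eq_one_iff.mp ?_).resolve_left fun h ↦ h3 (Units.ext h)
      rw [← Units.val_pow_eq_pow_val, h1, Units.val_one]
    have hval : (χ ^ 7) (((g ^ 666 : Fˣ) : F)) = -1 := by
      have h1 : ((χ ^ 14) g) = -1 := by
        refine (sq_eq_one_iff.mp ?_).resolve_left ?_
        · rw [← MulChar.pow_apply_coe, ← pow_mul, hpow, MulChar.one_apply_coe]
        · intro h
          exact hne 14 (by norm_num) ((MulChar.eq_iff hg _ 1).mpr (by rw [h, MulChar.one_apply_coe]))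
      rw [MulChar.pow_apply_coe] at h1
      rw [MulChar.pow_apply_coe, Units.val_pow_eq_pow_val, map_pow, ← pow_mul,
        show 666 * 7 = 14 * 333 by norm_num, pow_mul, h1]
      exact Odd.neg_one_pow (by decide)
    have hσ : ∀ x : F, iterateFrobenius F 11 3 x = x ^ 1331 := fun x ↦ by
      rw [iterateFrobenius_def]
      norm_num
    rw [gaussSum_eq_card_mul_of_trivial_on_fixedField h2 (σ := iterateFrobenius F 11 3)
      (q := 1331) (c := ((g ^ 666 : Fˣ) : F)) ?_ (hne 7 (by norm_num)) ?_ hψ1 ?_ (Units.ne_zero _)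
      ?_ ?_, hval]
    · norm_num
    · intro x
      rw [hσ, hσ, ← pow_mul]
      have := FiniteField.pow_card x
      rwa [hcard] at this
    · intro x hx hx0
      rw [hσ] at hx
      refine MulChar.apply_eq_one_of_pow_eq_one (N := 4) (m := 1330) ?_ (by norm_num) ?_ ?_
      · rw [← pow_mul, hpow]
      · rw [hcard]
        norm_num
      · refine mul_right_cancel₀ hx0 ?_
        rw [← pow_succ, hx, one_mul]
    · intro x
      rw [hσ, show 1331 = 11 * 11 * 11 by norm_num, pow_mul, pow_mul, hψfrob, hψfrob, hψfrob]
    · rw [hσ, ← Units.val_pow_eq_pow_val, ← pow_mul, show 666 * 1331 = 885780 + 666 by norm_num,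
        pow_add, hord2, neg_one_mul, Units.val_neg]
    · rw [hcard]
      norm_num
  -- The sign, from the congruence modulo `7`.
  obtain ⟨r, hr, h7⟩ := exists_isIntegral_gaussSum_pow_eq χ ψ (p := 7) (by norm_num)
  have hshift : gaussSum (χ ^ 7) (ψ ^ 7) = gaussSum (χ ^ 7) ψ := by
    have h70 : (7 : F) ≠ 0 := by
      have := (CharP.cast_eq_zero_iff F 11 7).not.mpr (by norm_num)
      exact_mod_cast this
    have h := gaussSum_mulShift (χ ^ 7) ψ (Units.mk0 7 h70)
    have hχ7 : (χ ^ 7) (7 : F) = 1 := by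
      have h : χ 7 = 1 := hnat 7 (by decide)
      rw [MulChar.pow_apply' _ (by norm_num), h, one_pow]
    rw [Units.val_mk0, hχ7, one_mul] at h
    rw [← h, show (7 : F) = ((7 : ℕ) : F) by norm_num, ← AddChar.pow_mulShift]
  rw [hshift, hquartic] at h7
  rcases sq_eq_sq_iff_eq_or_eq_neg.mp hsq with h | h
  · exfalso
    rw [h] at h7
    have := Int.dvd_of_isIntegral (n := 7) (m := 1331 ^ 7 + 1331) (by norm_num) hr (by
      push_cast at h7 ⊢
      linear_combination h7)
    norm_num at this
  · exact h
end

section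
/- There exists a multiplicative character χ of order 44 of the finite field F_q with q = 3^10 = 59049 such that the Gauss sum G(χ) = Σ_{x ∈ F_q} χ(x) ψ(x) ∈ ℂ equals 3⁴·(5 + i√11)/2, and G(χ̄) = 3⁴·(5 − i√11)/2, where χ̄ is the complex conjugate character. -/
/-- `f n`, in a form which makes the kernel evaluate `n` first. -/
def withEval (f : ℕ → ℕ) (n : ℕ) : ℕ :=
  Nat.rec (f 0) (fun m _ => f (m + 1)) n

theorem withEval_eq (f : ℕ → ℕ) (n : ℕ) : withEval f n = f n := by
  cases n <;> rfl

/-- `f 0 (f 1 (⋯ (f (n - 1) x)))`, evaluated from the inside. -/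
def countdown (f : ℕ → ℕ → ℕ) (n : ℕ) : ℕ → ℕ :=
  Nat.rec id (fun m ih x => withEval ih (f m x)) n

theorem countdown_eq (f : ℕ → ℕ → ℕ) (s : ℕ → ℕ) (n : ℕ) :
    ∀ i, (∀ k < n, f (n - 1 - k) (s (i + k)) = s (i + k + 1)) →
      countdown f n (s i) = s (i + n) := by
  induction n with
  | zero => intro i _; rfl
  | succ n ih =>
    intro i h
    have h0 := h 0 (by omega)
    simp only [Nat.add_sub_cancel, Nat.sub_zero, Nat.add_zero] at h0
    change withEval (countdown f n) (f n (s i)) = _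
    rw [withEval_eq, h0, ih (i + 1) fun k hk => ?_]
    · congr 1; omega
    · have := h (k + 1) (by omega)
      rw [show n + 1 - 1 - (k + 1) = n - 1 - k by omega] at this
      rw [show i + 1 + k = i + (k + 1) by omega]
      exact this

/-- Drop the lowest base `3` digit of a window and append the next term of the recurrence
`t (i + 10) = t (i + 3) + t (i + 1) + t i`. -/
def shiftStep (w : ℕ) : ℕ := w / 3 + (w + w / 3 + w / 27) % 3 * 3 ^ 9

/-- Shift the window in the lower part of `S` and record a zero digit in the upper part, at the
place of the residue class of `n` modulo `44`. -/
def tallyStep (n S : ℕ) : ℕ :=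
  (S / 3 ^ 10 + (1 - S % 3) * 2 ^ (10 * (n % 44))) * 3 ^ 10 + shiftStep (S % 3 ^ 10)

theorem pow_three_pow_ten_of_pow_ten {A : Type*} [CommRing A] (h3 : (3 : A) = 0) {a : A}
    (h : a ^ 10 = a ^ 3 + a + 1) : a ^ 3 ^ 10 = a := by
  have e2 : a ^ 3 ^ 2 = a ^ 9 := by norm_num
  have e3 : a ^ 3 ^ 3 = -1 + a - a ^ 2 + a ^ 6 + a ^ 7 - a ^ 8 + a ^ 9 := by
    rw [pow_succ 3 2, pow_mul, e2]
    linear_combination (-1 - a + a ^ 3 + a ^ 7 + a ^ 8 + a ^ 10 + a ^ 17) * h +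
      (-a + a ^ 8 + a ^ 10 + a ^ 11) * h3
  have e4 : a ^ 3 ^ 4 = -a - a ^ 2 + a ^ 3 - a ^ 4 - a ^ 6 + a ^ 8 - a ^ 9 := by
    rw [pow_succ 3 3, pow_mul, e3]
    linear_combination (1 + a + a ^ 2 + a ^ 3 - a ^ 5 - a ^ 8 + a ^ 10 + a ^ 11 - a ^ 14
        + a ^ 17) * h +
      (2 * a - a ^ 2 + 3 * a ^ 3 - a ^ 4 + a ^ 5 + a ^ 6 - a ^ 7 - a ^ 8 + 4 * a ^ 9 - 6 * a ^ 10
        + 6 * a ^ 11 - 4 * a ^ 12 + 2 * a ^ 14 - 3 * a ^ 15 - 2 * a ^ 16 + 5 * a ^ 17 - 5 * a ^ 18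
        + 4 * a ^ 19 - a ^ 20 - a ^ 21 + 2 * a ^ 22 - a ^ 24 + 2 * a ^ 25 - a ^ 26) * h3
  have e5 : a ^ 3 ^ 5 = -1 - a - a ^ 2 - a ^ 3 + a ^ 5 - a ^ 6 + a ^ 7 - a ^ 8 - a ^ 9 := by
    rw [pow_succ 3 4, pow_mul, e4]
    linear_combination (-1 - a ^ 2 - a ^ 3 + a ^ 4 + a ^ 5 + a ^ 8 - a ^ 10 + a ^ 14 - a ^ 17) * h
        +
      (-a ^ 3 - a ^ 4 + a ^ 6 - 2 * a ^ 7 + 2 * a ^ 11 - 6 * a ^ 12 + 2 * a ^ 13 + a ^ 14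
        - 2 * a ^ 15 + 2 * a ^ 16 - 6 * a ^ 17 + 4 * a ^ 18 - 3 * a ^ 20 + 2 * a ^ 21 - 2 * a ^ 22
        + 2 * a ^ 23 - a ^ 24 - a ^ 25 + a ^ 26) * h3
  have e6 : a ^ 3 ^ 6 = -1 + a - a ^ 2 - a ^ 3 + a ^ 5 + a ^ 6 + a ^ 7 - a ^ 8 := by
    rw [pow_succ 3 5, pow_mul, e5]
    linear_combination (a + a ^ 2 - a ^ 3 + a ^ 7 + a ^ 8 - a ^ 10 + a ^ 11 - a ^ 14 - a ^ 17) * h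
        +
      (-a - a ^ 2 - 3 * a ^ 3 - 4 * a ^ 4 - 3 * a ^ 5 - 3 * a ^ 6 + 2 * a ^ 8 - a ^ 9 - 3 * a ^ 10
        - 4 * a ^ 11 - 8 * a ^ 12 - 2 * a ^ 13 - a ^ 14 - a ^ 15 + 3 * a ^ 16 - a ^ 17
        - 6 * a ^ 18 + a ^ 19 - 5 * a ^ 20 - a ^ 21 + 2 * a ^ 22 - a ^ 23 + a ^ 24 - a ^ 26) * h3
  have e7 : a ^ 3 ^ 7 = 1 + a + a ^ 3 - a ^ 4 + a ^ 5 - a ^ 6 - a ^ 7 := by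
    rw [pow_succ 3 6, pow_mul, e6]
    linear_combination (-1 - a + a ^ 2 - a ^ 7 + a ^ 8 + a ^ 11 - a ^ 14) * h +
      (-1 - 2 * a ^ 2 + a ^ 3 - a ^ 5 + 2 * a ^ 7 - a ^ 8 + 4 * a ^ 9 - 3 * a ^ 10 + 2 * a ^ 11
        + 2 * a ^ 12 - a ^ 13 - 5 * a ^ 14 - 2 * a ^ 15 - a ^ 16 + 6 * a ^ 17 + 2 * a ^ 18
        - a ^ 19 - 2 * a ^ 20 - a ^ 21 + a ^ 23) * h3
  have e8 : a ^ 3 ^ 8 = 1 + a - a ^ 2 - a ^ 3 + a ^ 5 + a ^ 6 - a ^ 7 := by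
    rw [pow_succ 3 7, pow_mul, e7]
    linear_combination (a + a ^ 2 - a ^ 4 + a ^ 5 - a ^ 8 - a ^ 11) * h +
      (a + 2 * a ^ 2 + 2 * a ^ 3 + a ^ 4 + a ^ 6 - 3 * a ^ 7 - 2 * a ^ 8 - 2 * a ^ 9 - 4 * a ^ 10
        + 2 * a ^ 11 - 5 * a ^ 12 + 4 * a ^ 13 + a ^ 14 + a ^ 15 + 2 * a ^ 16 - a ^ 17 + a ^ 18
        - a ^ 20) * h3
  have e9 : a ^ 3 ^ 9 = 1 - a ^ 2 - a ^ 4 - a ^ 5 - a ^ 7 - a ^ 8 := by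
    rw [pow_succ 3 8, pow_mul, e8]
    linear_combination (-a ^ 2 - a ^ 4 + a ^ 5 + a ^ 8 - a ^ 11) * h +
      (a - 3 * a ^ 3 - 2 * a ^ 4 + 3 * a ^ 5 + 6 * a ^ 6 - 7 * a ^ 8 - 4 * a ^ 9 + 6 * a ^ 10
        + 7 * a ^ 11 - a ^ 12 - 7 * a ^ 13 - 2 * a ^ 14 + 4 * a ^ 15 + 2 * a ^ 16 - a ^ 17
        - 2 * a ^ 18 + a ^ 20) * h3
  have e10 : a ^ 3 ^ 10 = a := by
    rw [pow_succ 3 9, pow_mul, e9]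
    linear_combination (-1 - a + a ^ 2 + a ^ 4 + a ^ 5 - a ^ 7 - a ^ 11 - a ^ 14) * h +
      (-a - a ^ 2 + 2 * a ^ 6 + a ^ 7 - a ^ 8 + 3 * a ^ 9 + 2 * a ^ 10 - a ^ 11 + a ^ 12 - a ^ 13
        - 5 * a ^ 14 - 2 * a ^ 15 - 3 * a ^ 16 - 5 * a ^ 17 - 3 * a ^ 18 - 3 * a ^ 19 - 3 * a ^ 20
        - a ^ 21 - a ^ 22 - a ^ 23) * h3
  exact e10

open Polynomial in
theorem exists_pow_ten_eq (F : Type*) [Field F] [Fintype F] [Algebra (ZMod 3) F]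
    (hcard : Fintype.card F = 3 ^ 10) : ∃ g : F, g ^ 10 = g ^ 3 + g + 1 := by
  let m : (ZMod 3)[X] := X ^ 10 - (X ^ 3 + X + 1)
  have hdeg : m.natDegree = 10 := by simp only [m]; compute_degree!
  have hdvd : m ∣ X ^ 3 ^ 10 - X := by
    have h3 : (3 : AdjoinRoot m) = 0 := by
      have := congrArg (algebraMap (ZMod 3) (AdjoinRoot m)) (show (3 : ZMod 3) = 0 by decide)
      simpa only [map_ofNat, map_zero] using this
    have hroot : (AdjoinRoot.root m) ^ 10 = AdjoinRoot.root m ^ 3 + AdjoinRoot.root m + 1 := by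
      have := AdjoinRoot.mk_self (f := m)
      simp only [m, map_sub, map_add, map_pow, AdjoinRoot.mk_X, map_one] at this
      exact sub_eq_zero.mp this
    rw [← AdjoinRoot.mk_eq_zero, map_sub, map_pow, AdjoinRoot.mk_X,
      pow_three_pow_ten_of_pow_ten h3 hroot, sub_self]
  have hsplit : ((X ^ 3 ^ 10 - X : (ZMod 3)[X]).map (algebraMap (ZMod 3) F)).Splits := by
    rw [← hcard]
    exact (FiniteField.isSplittingField_sub F (ZMod 3)).splits
  have hne : (X ^ 3 ^ 10 - X : (ZMod 3)[X]) ≠ 0 :=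
    FiniteField.X_pow_card_sub_X_ne_zero _ (by norm_num)
  have hm : (m.map (algebraMap (ZMod 3) F)).Splits :=
    hsplit.of_dvd (Polynomial.map_ne_zero hne) (Polynomial.map_dvd _ hdvd)
  obtain ⟨g, hg⟩ := hm.exists_eval_eq_zero (by
    rw [degree_map]
    exact degree_ne_of_natDegree_ne (by rw [hdeg]; norm_num))
  refine ⟨g, ?_⟩
  simp only [m, Polynomial.map_sub, Polynomial.map_add, Polynomial.map_pow, map_X,
    Polynomial.map_one, eval_sub, eval_add, eval_pow, eval_X, eval_one] at hg
  exact sub_eq_zero.mp hg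

section

variable {F : Type*} [Field F] [Algebra (ZMod 3) F]

theorem trace_pow_add_ten {g : F} (hg : g ^ 10 = g ^ 3 + g + 1) (n : ℕ) :
    Algebra.trace (ZMod 3) F (g ^ (n + 10)) = Algebra.trace (ZMod 3) F (g ^ (n + 3)) +
      Algebra.trace (ZMod 3) F (g ^ (n + 1)) + Algebra.trace (ZMod 3) F (g ^ n) := by
  rw [← map_add, ← map_add]
  congr 1
  linear_combination g ^ n * hg

variable [Fintype F]

theorem trace_pow_three (x : F) :
    Algebra.trace (ZMod 3) F (x ^ 3) = Algebra.trace (ZMod 3) F x := by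
  have := Algebra.trace_eq_of_algEquiv (FiniteField.frobeniusAlgEquivOfAlgebraic (ZMod 3) F) x
  simpa [FiniteField.coe_frobeniusAlgEquivOfAlgebraic, ZMod.card] using this

theorem trace_pow_of_lt_ten (hcard : Fintype.card F = 3 ^ 10) {g : F}
    (hg : g ^ 10 = g ^ 3 + g + 1) {i : ℕ} (hi : i < 10) :
    Algebra.trace (ZMod 3) F (g ^ i) = if i = 0 ∨ i = 7 then 1 else 0 := by
  set u : ℕ → ZMod 3 := fun n => Algebra.trace (ZMod 3) F (g ^ n) with hu
  have rec_u : ∀ n, u (n + 10) = u (n + 3) + u (n + 1) + u n := trace_pow_add_ten hg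
  have frob_u : ∀ n, u (n * 3) = u n := fun n => by
    simp only [hu, pow_mul, trace_pow_three]
  have u0 : u 0 = 1 := by
    have hrank : Module.finrank (ZMod 3) F = 10 := by
      have := Module.card_eq_pow_finrank (K := ZMod 3) (V := F)
      rw [hcard, ZMod.card] at this
      exact (Nat.pow_right_injective (le_refl 2 |>.trans (by norm_num)) this).symm
    have := Algebra.trace_algebraMap (R := ZMod 3) (S := F) 1
    rw [map_one, hrank] at this
    simp only [hu, pow_zero, this]
    decide
  have h1 := frob_u 1
  have h2 := frob_u 2
  have h3 := frob_u 3
  have h4 := frob_u 4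
  have h5 := frob_u 5
  have h6 := frob_u 6
  have h7 := frob_u 7
  have h8 := frob_u 8
  have h9 := frob_u 9
  simp only [Nat.reduceMul, rec_u 0, rec_u 1, rec_u 2, rec_u 3, rec_u 4, rec_u 5, rec_u 7, rec_u 8,
   
    rec_u 10, rec_u 11, rec_u 14, rec_u 17, Nat.reduceAdd, u0] at h1 h2 h3 h4 h5 h6 h7 h8 h9
  have u1 : u 1 = 0 := by grind
  have u2 : u 2 = 0 := by grind
  have u4 : u 4 = 0 := by grind
  have u5 : u 5 = 0 := by grind
  have u7 : u 7 = 1 := by grind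
  have u8 : u 8 = 0 := by grind
  change u i = _
  interval_cases i <;> simp_all only <;> rfl
end

theorem sum_range_mul_eq {M : Type*} [AddCommMonoid M] (f : ℕ → M) (m n : ℕ) :
    ∑ i ∈ Finset.range (n * m), f i =
      ∑ r ∈ Finset.range n, ∑ q ∈ Finset.range m, f (r + n * q) := by
  induction m with
  | zero => simp
  | succ m ih =>
    rw [Nat.mul_succ, Finset.sum_range_add, ih, ← Finset.sum_add_distrib]
    refine Finset.sum_congr rfl fun r _ => ?_
    rw [Finset.sum_range_succ, add_comm (n * m)]

theorem sum_mul_pow_div_mod (B : ℕ) : ∀ (n : ℕ) (a : ℕ → ℕ), (∀ i < n, a i < B) →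
    ∀ k < n, (∑ i ∈ Finset.range n, a i * B ^ i) / B ^ k % B = a k := by
  intro n
  induction n with
  | zero => intro a _ k hk; omega
  | succ n ih =>
    intro a ha k hk
    have h0 := ha 0 (by omega)
    have hs : ∑ i ∈ Finset.range (n + 1), a i * B ^ i =
        a 0 + B * ∑ i ∈ Finset.range n, a (i + 1) * B ^ i := by
      rw [Finset.sum_range_succ', Finset.mul_sum, add_comm, pow_zero, mul_one]
      congr 1
      exact Finset.sum_congr rfl fun i _ => by ring
    rw [hs]
    cases k with
    | zero => rw [pow_zero, Nat.div_one, Nat.add_mul_mod_self_left, Nat.mod_eq_of_lt h0]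
    | succ k =>
      rw [pow_succ', ← Nat.div_div_eq_div_mul, Nat.add_mul_div_left _ _ (by omega),
        Nat.div_eq_of_lt h0, zero_add]
      exact ih (fun i => a (i + 1)) (fun i hi => ha _ (by omega)) k (by omega)

section
variable {t : ℕ → ℕ}

/-- Ten consecutive values of `t`, packed in base `3`. -/
def window (t : ℕ → ℕ) (i : ℕ) : ℕ := ∑ j ∈ Finset.range 10, t (i + j) * 3 ^ j

theorem window_zero (h0 : ∀ i < 10, t i = if i = 0 ∨ i = 7 then 1 else 0) :
    window t 0 = 2188 := by
  simp [window, Finset.sum_range_succ, h0]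

theorem window_lt (h3 : ∀ i, t i < 3) (i : ℕ) : window t i < 3 ^ 10 := by
  have := fun j => h3 (i + j)
  have b0 := this 0; have b1 := this 1; have b2 := this 2; have b3 := this 3; have b4 := this 4
  have b5 := this 5; have b6 := this 6; have b7 := this 7; have b8 := this 8; have b9 := this 9
  simp only [window, Finset.sum_range_succ, Finset.sum_range_zero]
  omega

theorem window_mod_three (i : ℕ) (h3 : ∀ i, t i < 3) : window t i % 3 = t i := by
  have b0 := h3 i
  simp only [window, Finset.sum_range_succ, Finset.sum_range_zero, add_zero]
  omega

theorem shiftStep_window (h3 : ∀ i, t i < 3)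
    (hrec : ∀ i, t (i + 10) = (t (i + 3) + t (i + 1) + t i) % 3) (i : ℕ) :
    shiftStep (window t i) = window t (i + 1) := by
  have := fun j => h3 (i + j)
  have b0 := h3 i; have b1 := this 1; have b2 := this 2; have b3 := this 3; have b4 := this 4
  have b5 := this 5; have b6 := this 6; have b7 := this 7; have b8 := this 8; have b9 := this 9
  have hr := hrec i
  have hw : window t i = t i + t (i + 1) * 3 + t (i + 2) * 3 ^ 2 + t (i + 3) * 3 ^ 3 +
      t (i + 4) * 3 ^ 4 + t (i + 5) * 3 ^ 5 + t (i + 6) * 3 ^ 6 + t (i + 7) * 3 ^ 7 +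
      t (i + 8) * 3 ^ 8 + t (i + 9) * 3 ^ 9 := by
    simp [window, Finset.sum_range_succ]
  have hw' : window t (i + 1) = t (i + 1) + t (i + 2) * 3 + t (i + 3) * 3 ^ 2 +
      t (i + 4) * 3 ^ 3 + t (i + 5) * 3 ^ 4 + t (i + 6) * 3 ^ 5 + t (i + 7) * 3 ^ 6 +
      t (i + 8) * 3 ^ 7 + t (i + 9) * 3 ^ 8 + t (i + 10) * 3 ^ 9 := by
    simp [window, Finset.sum_range_succ, add_assoc]
  generalize window t i = w at hw ⊢
  have hw3 : w / 3 = t (i + 1) + t (i + 2) * 3 + t (i + 3) * 3 ^ 2 + t (i + 4) * 3 ^ 3 +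
      t (i + 5) * 3 ^ 4 + t (i + 6) * 3 ^ 5 + t (i + 7) * 3 ^ 6 + t (i + 8) * 3 ^ 7 +
      t (i + 9) * 3 ^ 8 := by omega
  have hw27 : w / 27 = t (i + 3) + t (i + 4) * 3 + t (i + 5) * 3 ^ 2 + t (i + 6) * 3 ^ 3 +
      t (i + 7) * 3 ^ 4 + t (i + 8) * 3 ^ 5 + t (i + 9) * 3 ^ 6 := by omega
  have hmod : (w + w / 3 + w / 27) % 3 = (t (i + 3) + t (i + 1) + t i) % 3 := by omega
  rw [shiftStep, hmod, hw3, hw', hr]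

theorem countdown_shiftStep_window (h3 : ∀ i, t i < 3)
    (hrec : ∀ i, t (i + 10) = (t (i + 3) + t (i + 1) + t i) % 3)
    (h0 : ∀ i < 10, t i = if i = 0 ∨ i = 7 then 1 else 0) (n : ℕ) :
    countdown (fun _ => shiftStep) n 2188 = window t n := by
  have := countdown_eq (fun _ => shiftStep) (window t) n 0
    fun k _ => shiftStep_window h3 hrec (0 + k)
  rwa [window_zero h0, zero_add] at this

theorem countdown_tallyStep (h3 : ∀ i, t i < 3)
    (hrec : ∀ i, t (i + 10) = (t (i + 3) + t (i + 1) + t i) % 3)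
    (h0 : ∀ i < 10, t i = if i = 0 ∨ i = 7 then 1 else 0) (n : ℕ) :
    countdown tallyStep n 2188 =
      (∑ k ∈ Finset.range n, (1 - t k) * 2 ^ (10 * ((n - 1 - k) % 44))) * 3 ^ 10 +
        window t n := by
  have := countdown_eq tallyStep (fun i =>
    (∑ k ∈ Finset.range i, (1 - t k) * 2 ^ (10 * ((n - 1 - k) % 44))) * 3 ^ 10 + window t i) n 0
    fun k _ => ?_
  · simpa [window_zero h0] using this
  · simp only [zero_add, Finset.sum_range_succ _ k, ← shiftStep_window h3 hrec k, tallyStep]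
    have hlt := window_lt h3 k
    have hmod := window_mod_three k h3
    generalize ∑ k ∈ Finset.range k, (1 - t k) * 2 ^ (10 * ((n - 1 - k) % 44)) = A
    rw [show (A * 3 ^ 10 + window t k) % 3 = t k by omega,
      show (A * 3 ^ 10 + window t k) / 3 ^ 10 = A by omega,
      show (A * 3 ^ 10 + window t k) % 3 ^ 10 = window t k by omega]

/-- The numbers of zeros of `t` in the residue classes `43, …, 1, 0` modulo `44` among the indices
below `44 * 671`, packed as digits in base `1024`. -/
def packedCounts : ℕ :=
  763107566054283508176566266651908598293197423201090266309521449605585306743600628707772528895642535320461429506571429753096532882644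

theorem count_eq_and_window_eq (h3 : ∀ i, t i < 3)
    (hrec : ∀ i, t (i + 10) = (t (i + 3) + t (i + 1) + t i) % 3)
    (h0 : ∀ i < 10, t i = if i = 0 ∨ i = 7 then 1 else 0) :
    (∀ r < 44, ∑ q ∈ Finset.range 671, (1 - t (r + 44 * q)) =
      packedCounts / 1024 ^ (43 - r) % 1024) ∧ window t 29524 = 4376 := by
  have hrun : countdown tallyStep 29524 2188 =
      packedCounts * 3 ^ 10 + 4376 := by
    decide +kernel
  rw [countdown_tallyStep h3 hrec h0] at hrun
  have hlt := window_lt h3 29524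
  generalize window t 29524 = w at hrun hlt ⊢
  generalize packedCounts = T at hrun ⊢
  have hsum : ∑ k ∈ Finset.range 29524, (1 - t k) * 2 ^ (10 * ((29524 - 1 - k) % 44)) = T := by
    omega
  refine ⟨fun r hr => ?_, by omega⟩
  rw [show Finset.range 29524 = Finset.range (44 * 671) by norm_num, sum_range_mul_eq,
    ← Finset.sum_range_reflect] at hsum
  have hdigit := sum_mul_pow_div_mod 1024 44
    (fun j => ∑ q ∈ Finset.range 671, (1 - t (43 - j + 44 * q)))
    (fun j _ => (Finset.sum_le_sum fun q _ => Nat.sub_le 1 _).trans_lt (by simp)) (43 - r)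
    (by omega)
  rw [show 43 - (43 - r) = r by omega] at hdigit
  rw [← hdigit, ← hsum]
  refine congrArg (fun s => s / 1024 ^ (43 - r) % 1024) (Finset.sum_congr rfl fun j hj => ?_)
  rw [Finset.mem_range] at hj
  rw [Finset.sum_mul]
  refine Finset.sum_congr rfl fun q hq => ?_
  rw [Finset.mem_range] at hq
  rw [show (29524 - 1 - (44 - 1 - j + 44 * q)) % 44 = j by omega, pow_mul]
  norm_num

end

section

variable {F : Type*} [Field F] [Fintype F]

theorem pow_eq_one_of_card_eq {g : F} (hcard : Fintype.card F = 3 ^ 10) (hg : g ≠ 0) :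
    g ^ 59048 = 1 := by
  simpa [hcard] using FiniteField.pow_card_sub_one_eq_one g hg

theorem sum_eq_zero_add_sum_pow {M : Type*} [AddCommMonoid M] {g : F} (hg : g ≠ 0)
    (hord : orderOf g = Fintype.card F - 1) (f : F → M) :
    ∑ x, f x = f 0 + ∑ i ∈ Finset.range (orderOf g), f (g ^ i) := by
  classical
  have hinj : Set.InjOn (fun i => g ^ i) (Finset.range (orderOf g) : Set ℕ) := by
    rw [Finset.coe_range]; exact pow_injOn_Iio_orderOf
  have hnot : (0 : F) ∉ (Finset.range (orderOf g)).image (fun i => g ^ i) := by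
    simp [hg]
  have huniv : insert 0 ((Finset.range (orderOf g)).image (fun i => g ^ i)) = Finset.univ := by
    rw [← Finset.card_eq_iff_eq_univ, Finset.card_insert_of_notMem hnot,
      Finset.card_image_of_injOn hinj, Finset.card_range, hord]
    have := Fintype.card_pos (α := F)
    omega
  rw [← huniv, Finset.sum_insert hnot, Finset.sum_image hinj]

variable [Algebra (ZMod 3) F]

theorem trace_pow_val_properties (hcard : Fintype.card F = 3 ^ 10) {g : F}
    (hg : g ^ 10 = g ^ 3 + g + 1) {t : ℕ → ℕ}
    (ht : t = fun i => (Algebra.trace (ZMod 3) F (g ^ i)).val) :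
    (∀ i, t i < 3) ∧ (∀ i, t (i + 10) = (t (i + 3) + t (i + 1) + t i) % 3) ∧
      ∀ i < 10, t i = if i = 0 ∨ i = 7 then 1 else 0 := by
  subst ht
  refine ⟨fun i => ZMod.val_lt _, fun i => ?_, fun i hi => ?_⟩
  · simp only [trace_pow_add_ten hg, ZMod.val_add, Nat.mod_add_mod]
  · simp only [trace_pow_of_lt_ten hcard hg hi]
    split_ifs <;> rfl

theorem orderOf_eq_of_pow_ten_eq (hcard : Fintype.card F = 3 ^ 10) {g : F}
    (hg : g ^ 10 = g ^ 3 + g + 1) : orderOf g = 59048 := by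
  have hg0 : g ≠ 0 := by rintro rfl; norm_num at hg
  obtain ⟨h3, hrec, h0⟩ := trace_pow_val_properties hcard hg rfl
  have hne : ∀ n, window (fun i => (Algebra.trace (ZMod 3) F (g ^ i)).val) n ≠ 2188 →
      g ^ n ≠ 1 := by
    intro n hn h1
    refine hn ?_
    rw [← window_zero h0]
    simp only [window, pow_add, h1, pow_zero]
  refine orderOf_eq_of_pow_and_pow_div_prime (by norm_num)
    (pow_eq_one_of_card_eq hcard hg0) fun p hp hdvd => hne _ ?_
  have hfac : 59048 = 2 ^ 3 * (11 ^ 2 * 61) := by norm_num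
  rw [hfac, hp.dvd_mul, hp.dvd_mul] at hdvd
  have hp' : p = 2 ∨ p = 11 ∨ p = 61 := by
    rcases hdvd with h | h | h
    · exact .inl ((Nat.prime_dvd_prime_iff_eq hp (by norm_num)).1 (hp.dvd_of_dvd_pow h))
    · exact .inr (.inl ((Nat.prime_dvd_prime_iff_eq hp (by norm_num)).1 (hp.dvd_of_dvd_pow h)))
    · exact .inr (.inr ((Nat.prime_dvd_prime_iff_eq hp (by norm_num)).1 h))
  rcases hp' with rfl | rfl | rfl
  · rw [show 59048 / 2 = 29524 by norm_num, (count_eq_and_window_eq h3 hrec h0).2]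
    norm_num
  · rw [show 59048 / 11 = 5368 by norm_num, ← countdown_shiftStep_window h3 hrec h0]
    decide +kernel
  · rw [show 59048 / 61 = 968 by norm_num, ← countdown_shiftStep_window h3 hrec h0]
    decide +kernel

end

theorem exp_val_add_exp_neg_val (y : ZMod 3) :
    Complex.exp (2 * (Real.pi : ℂ) * Complex.I * (y.val : ℂ) / 3) +
      Complex.exp (2 * (Real.pi : ℂ) * Complex.I * ((-y).val : ℂ) / 3) =
      3 * ((1 - y.val : ℕ) : ℂ) - 1 := by
  have hω := Complex.isPrimitiveRoot_exp 3 (by norm_num)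
  have hsum := hω.geom_sum_eq_zero (by norm_num)
  rw [Finset.sum_range_succ, Finset.sum_range_succ, Finset.sum_range_one, pow_zero, pow_one,
    ← Complex.exp_nat_mul] at hsum
  push_cast at hsum
  have v1 : (1 : ZMod 3).val = 1 := rfl
  have v2 : (2 : ZMod 3).val = 2 := rfl
  have e1 : 2 * (Real.pi : ℂ) * Complex.I * ((1 : ℕ) : ℂ) / 3 = 2 * Real.pi * Complex.I / 3 := by
    push_cast; ring
  have e2 : 2 * (Real.pi : ℂ) * Complex.I * ((2 : ℕ) : ℂ) / 3 =
      2 * (2 * Real.pi * Complex.I / 3) := by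
    push_cast; ring
  obtain rfl | rfl | rfl : y = 0 ∨ y = 1 ∨ y = 2 := by revert y; decide
  · norm_num
  · rw [show (-1 : ZMod 3) = 2 by decide, v1, v2, e1, e2]
    push_cast
    linear_combination hsum
  · rw [show (-2 : ZMod 3) = 1 by decide, v1, v2, e1, e2]
    push_cast
    linear_combination hsum

/-- The quadratic Gauss sum modulo `11` at `ξ ^ 4`, for `ξ` a primitive `44`-th root of unity. -/
noncomputable def quadraticSum (ξ : ℂ) : ℂ :=
  ξ ^ 2 + ξ ^ 4 + ξ ^ 6 - ξ ^ 8 + ξ ^ 10 + ξ ^ 12 - ξ ^ 14 + ξ ^ 16 + ξ ^ 18 + ξ ^ 20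

section

variable {ξ : ℂ}

theorem IsPrimitiveRoot.pow_twenty_two_eq_neg_one (hξ : IsPrimitiveRoot ξ 44) : ξ ^ 22 = -1 := by
  have h : (ξ ^ 22 - 1) * (ξ ^ 22 + 1) = 0 := by linear_combination hξ.pow_eq_one
  have hne : ξ ^ 22 - 1 ≠ 0 := sub_ne_zero.2
    (hξ.pow_ne_one_of_pos_of_lt (by norm_num) (by norm_num))
  exact eq_neg_of_add_eq_zero_left ((mul_eq_zero.1 h).resolve_left hne)

theorem IsPrimitiveRoot.cyclotomic_forty_four_eq_zero (hξ : IsPrimitiveRoot ξ 44) :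
    1 - ξ ^ 2 + ξ ^ 4 - ξ ^ 6 + ξ ^ 8 - ξ ^ 10 + ξ ^ 12 - ξ ^ 14 + ξ ^ 16 - ξ ^ 18 +
      ξ ^ 20 = 0 := by
  have hne : ξ ^ 2 + 1 ≠ 0 := fun h =>
    hξ.pow_ne_one_of_pos_of_lt (l := 4) (by norm_num) (by norm_num)
      (by linear_combination (ξ ^ 2 - 1) * h)
  refine (mul_eq_zero.1 ?_).resolve_left hne
  linear_combination hξ.pow_twenty_two_eq_neg_one

theorem IsPrimitiveRoot.quadraticSum_sq (hξ : IsPrimitiveRoot ξ 44) : quadraticSum ξ ^ 2 = -11 := by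
  rw [quadraticSum]
  linear_combination (11 + 11 * ξ ^ 2 + ξ ^ 4 + 3 * ξ ^ 6 + 5 * ξ ^ 8 + 3 * ξ ^ 10 + ξ ^ 12 +
    3 * ξ ^ 14 + 5 * ξ ^ 16 + 3 * ξ ^ 18 + ξ ^ 20) * hξ.cyclotomic_forty_four_eq_zero

theorem quadraticSum_eq_or (hξ : IsPrimitiveRoot ξ 44) :
    quadraticSum ξ = Complex.I * (Real.sqrt 11 : ℂ) ∨
      quadraticSum ξ = -(Complex.I * (Real.sqrt 11 : ℂ)) := by
  have h11 : (Real.sqrt 11 : ℂ) ^ 2 = 11 := by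
    rw [← Complex.ofReal_pow, Real.sq_sqrt (by norm_num)]; norm_num
  refine sq_eq_sq_iff_eq_or_eq_neg.1 ?_
  rw [hξ.quadraticSum_sq, mul_pow, Complex.I_sq, h11, neg_one_mul]

theorem quadraticSum_conj (ξ : ℂ) :
    quadraticSum ((starRingEnd ℂ) ξ) = (starRingEnd ℂ) (quadraticSum ξ) := by
  simp only [quadraticSum, map_add, map_sub, map_pow]

variable {F : Type*} [Field F] [Fintype F] [Algebra (ZMod 3) F]

theorem sum_pow_range_eq_zero (hξ : IsPrimitiveRoot ξ 44) :
    ∑ i ∈ Finset.range (44 * 671), ξ ^ i = 0 := by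
  rw [sum_range_mul_eq, Finset.sum_comm]
  refine Finset.sum_eq_zero fun q _ => ?_
  simp only [pow_add, pow_mul, hξ.pow_eq_one, one_pow, mul_one]
  exact hξ.geom_sum_eq_zero (by norm_num)

theorem sum_mul_exp_trace_eq (hcard : Fintype.card F = 3 ^ 10) {g : F}
    (hg : g ^ 10 = g ^ 3 + g + 1) (hξ : IsPrimitiveRoot ξ 44) (f : F → ℂ) (f0 : f 0 = 0)
    (hf : ∀ i : ℕ, f (g ^ i) = ξ ^ i) :
    ∑ x : F, f x * Complex.exp (2 * (Real.pi : ℂ) * Complex.I *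
        ((Algebra.trace (ZMod 3) F x).val : ℂ) / 3) = 3 ^ 4 * (5 + quadraticSum ξ) / 2 := by
  have hg0 : g ≠ 0 := by rintro rfl; norm_num at hg
  have hord := orderOf_eq_of_pow_ten_eq hcard hg
  have hneg : g ^ (44 * 671) = -1 := by
    have h1 : (g ^ (44 * 671) - 1) * (g ^ (44 * 671) + 1) = 0 := by
      linear_combination pow_eq_one_of_card_eq hcard hg0
    refine eq_neg_of_add_eq_zero_left ((mul_eq_zero.1 h1).resolve_left (sub_ne_zero.2 ?_))
    exact pow_ne_one_of_lt_orderOf (by norm_num) (by rw [hord]; norm_num)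
  obtain ⟨h3, hrec, h0⟩ := trace_pow_val_properties hcard hg rfl
  have hcount := (count_eq_and_window_eq h3 hrec h0).1
  rw [sum_eq_zero_add_sum_pow hg0 (by rw [hord, hcard]; norm_num), f0, zero_mul, zero_add, hord,
    show 59048 = 44 * 671 + 44 * 671 by norm_num, Finset.sum_range_add, ← Finset.sum_add_distrib]
  have hterm : ∀ i ∈ Finset.range (44 * 671),
      f (g ^ i) * Complex.exp (2 * (Real.pi : ℂ) * Complex.I *
          ((Algebra.trace (ZMod 3) F (g ^ i)).val : ℂ) / 3) +
        f (g ^ (44 * 671 + i)) * Complex.exp (2 * (Real.pi : ℂ) * Complex.I *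
          ((Algebra.trace (ZMod 3) F (g ^ (44 * 671 + i))).val : ℂ) / 3) =
      3 * (ξ ^ i * ((1 - (Algebra.trace (ZMod 3) F (g ^ i)).val : ℕ) : ℂ)) - ξ ^ i := by
    intro i _
    have := exp_val_add_exp_neg_val (Algebra.trace (ZMod 3) F (g ^ i))
    rw [hf, hf, pow_add g, hneg, neg_one_mul, map_neg, pow_add ξ, pow_mul, hξ.pow_eq_one, one_pow,
      one_mul, ← mul_add, this]
    ring
  rw [Finset.sum_congr rfl hterm, Finset.sum_sub_distrib, sum_pow_range_eq_zero hξ, sub_zero,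
    ← Finset.mul_sum, sum_range_mul_eq]
  have hclass : ∀ r ∈ Finset.range 44, ∑ q ∈ Finset.range 671, ξ ^ (r + 44 * q) *
      ((1 - (Algebra.trace (ZMod 3) F (g ^ (r + 44 * q))).val : ℕ) : ℂ) = ξ ^ r *
      ((packedCounts / 1024 ^ (43 - r) % 1024 : ℕ) : ℂ) := by
    intro r hr
    rw [← hcount r (Finset.mem_range.1 hr), Nat.cast_sum, Finset.mul_sum]
    refine Finset.sum_congr rfl fun q _ => ?_
    rw [pow_add, pow_mul, hξ.pow_eq_one, one_pow, mul_one]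
  rw [Finset.sum_congr rfl hclass]
  simp only [Finset.sum_range_succ, Finset.sum_range_zero, quadraticSum, packedCounts]
  norm_num only
  linear_combination (1245 + 1380 * ξ + 2598 * ξ ^ 2 + 2760 * ξ ^ 3 + 2598 * ξ ^ 4 + 2760 * ξ ^
    5 + 2598 * ξ ^ 6 +
    2652 * ξ ^ 7 + 2706 * ξ ^ 8 + 2652 * ξ ^ 9 + 2706 * ξ ^ 10 + 2760 * ξ ^ 11 + 2598 * ξ ^
    12 + 2652 * ξ ^ 13 + 2652 * ξ ^ 14 + 2652 * ξ ^ 15 + 2652 * ξ ^ 16 + 2652 * ξ ^ 17 +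
    2598 * ξ ^ 18 + 2544 * ξ ^ 19 + 2598 * ξ ^ 20 + 2544 * ξ ^ 21 + 1326 * ξ ^ 22 + 1272 * ξ
    ^ 23) / 2 * hξ.cyclotomic_forty_four_eq_zero

end

/-- **Evaluation of a Gauss sum of order 44 over `F_{3¹⁰}`.**
There exists a multiplicative character `χ` of order `44` of the finite field `F` with
`3¹⁰ = 59049` elements such that the Gauss sum
`G(χ) = ∑ x, χ x · exp(2πi·T(x)/3)` equals `3⁴·(5 + i√11)/2`, and the Gauss sum of the
complex-conjugate character `χ̄` (given by `x ↦ conj (χ x)`) equals `3⁴·(5 − i√11)/2`. -/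
theorem gauss_sum_order_44_card_3_pow_10
    (F : Type) [Field F] [Fintype F] [Algebra (ZMod 3) F]
    (hcard : Fintype.card F = 3 ^ 10) :
    ∃ χ : MulChar F ℂ, orderOf χ = 44 ∧
    (∑ x : F, χ x * Complex.exp (2 * (Real.pi : ℂ) * Complex.I *
        ((Algebra.trace (ZMod 3) F x).val : ℂ) / 3)) =
      3 ^ 4 * (5 + Complex.I * (Real.sqrt 11 : ℂ)) / 2 ∧
    (∑ x : F, (starRingEnd ℂ) (χ x) * Complex.exp (2 * (Real.pi : ℂ) * Complex.I *
        ((Algebra.trace (ZMod 3) F x).val : ℂ) / 3)) =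
      3 ^ 4 * (5 - Complex.I * (Real.sqrt 11 : ℂ)) / 2 := by
  obtain ⟨g, hg⟩ := exists_pow_ten_eq F hcard
  have hg0 : g ≠ 0 := by rintro rfl; norm_num at hg
  have hord := orderOf_eq_of_pow_ten_eq hcard hg
  have hgen : ∀ x : Fˣ, x ∈ Subgroup.zpowers (Units.mk0 g hg0) := by
    refine fun x => (Subgroup.eq_top_iff' _).1 (Subgroup.eq_top_of_card_eq _ ?_) x
    rw [Nat.card_zpowers, ← orderOf_units, Units.val_mk0, hord, Nat.card_units,
      Nat.card_eq_fintype_card, hcard]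
    norm_num
  have hprim : ∀ χ : MulChar F ℂ, orderOf χ = 44 → IsPrimitiveRoot (χ g) 44 := by
    intro χ hχ
    have hiff : ∀ n, χ g ^ n = 1 ↔ χ ^ n = 1 := fun n => by
      rw [MulChar.eq_iff hgen, MulChar.pow_apply_coe, MulChar.one_apply_coe, Units.val_mk0]
    refine IsPrimitiveRoot.mk ((hiff 44).2 (hχ ▸ pow_orderOf_eq_one χ)) fun l hl => ?_
    exact hχ ▸ orderOf_dvd_of_pow_eq_one ((hiff l).1 hl)
  obtain ⟨χ, hχ, hsum⟩ : ∃ χ : MulChar F ℂ, orderOf χ = 44 ∧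
      quadraticSum (χ g) = Complex.I * (Real.sqrt 11 : ℂ) := by
    obtain ⟨χ, hχ⟩ := MulChar.exists_mulChar_orderOf F (n := 44) (by rw [hcard]; norm_num)
      (Complex.isPrimitiveRoot_exp 44 (by norm_num))
    obtain h | h := quadraticSum_eq_or (hprim χ hχ)
    · exact ⟨χ, hχ, h⟩
    · refine ⟨χ⁻¹, by rw [orderOf_inv, hχ], ?_⟩
      rw [← MulChar.star_apply', RCLike.star_def, quadraticSum_conj, h]
      simp
  refine ⟨χ, hχ, ?_, ?_⟩
  · rw [sum_mul_exp_trace_eq hcard hg (hprim χ hχ) χ χ.map_zero (fun i => map_pow χ g i), hsum]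
  · rw [sum_mul_exp_trace_eq hcard hg
      ((hprim χ hχ).map_of_injective (starRingEnd ℂ).injective) (fun x => (starRingEnd ℂ) (χ x))
      (by rw [χ.map_zero, map_zero]) (fun i => by rw [map_pow, map_pow]), quadraticSum_conj, hsum]
    simp [sub_eq_add_neg]
end

section
/- There exists a multiplicative character χ of order 35 of the finite field F_q with q = 79^6 such that the Gauss sum G(χ) = Σ_{x ∈ F_q} χ(x) ψ(x) ∈ ℂ equals (79²/2)·(1 − 3i√35)·(4 + 3i√7); moreover, the Gauss sums of the conjugate characters take the values (79²/2)·(1 + 3i√35)·(4 + 3i√7), (79²/2)·(1 − 3i√35)·(4 − 3i√7), and (79²/2)·(1 + 3i√35)·(4 − 3i√7) at χ², χ³, and χ^{−1} respectively, for a suitable such χ. -/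
section GaussSumDivisibility

variable {F R : Type*} [Field F] [Fintype F] [CommRing R] [IsDomain R]

theorem gaussSum_mul_dvd (χ φ : MulChar F R) {ψ : AddChar F R} (hψ : ψ ≠ 1) :
    gaussSum (χ * φ) ψ ∣ gaussSum χ ψ * gaussSum φ ψ := by
  by_cases h : χ * φ = 1
  · rw [h, gaussSum_one_left hψ]
    exact (isUnit_one.neg).dvd
  · exact ⟨_, (jacobiSum_mul_nontrivial h ψ).symm⟩

theorem gaussSum_pow_dvd (χ : MulChar F R) {ψ : AddChar F R} (hψ : ψ ≠ 1) (n : ℕ) :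
    gaussSum (χ ^ n) ψ ∣ gaussSum χ ψ ^ n := by
  induction n with
  | zero => simp [gaussSum_one_left hψ]
  | succ n ih =>
    rw [pow_succ, pow_succ]
    exact (gaussSum_mul_dvd _ _ hψ).trans (mul_dvd_mul_right ih _)

theorem gaussSum_mul_gaussSum_inv {χ : MulChar F R} (hχ : χ ≠ 1) {ψ : AddChar F R} (hψ : ψ ≠ 1) :
    gaussSum χ ψ * gaussSum χ⁻¹ ψ = χ⁻¹ (-1) * Fintype.card F := by
  rw [← mul_gaussSum_inv_eq_gaussSum χ⁻¹, mul_left_comm,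
    gaussSum_mul_gaussSum_eq_card hχ (AddChar.IsPrimitive.of_ne_one hψ)]

variable {p : ℕ} [Fact p.Prime] [Algebra (ZMod p) F]

variable (F) in
/-- The additive character of `F` obtained by composing a character of `ZMod p` with the trace. -/
noncomputable def traceChar (ψ : AddChar (ZMod p) R) : AddChar F R :=
  ψ.compAddMonoidHom (Algebra.trace (ZMod p) F).toAddMonoidHom

omit [Fintype F] [IsDomain R] in
theorem traceChar_apply (ψ : AddChar (ZMod p) R) (x : F) :
    traceChar F ψ x = ψ (Algebra.trace (ZMod p) F x) := rfl

omit [IsDomain R] in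
theorem traceChar_ne_one {ψ : AddChar (ZMod p) R} (hψ : ψ ≠ 1) : traceChar F ψ ≠ 1 := by
  obtain ⟨t, ht⟩ := AddChar.ne_one_iff.1 hψ
  obtain ⟨x, rfl⟩ := Algebra.trace_surjective (ZMod p) F t
  exact AddChar.ne_one_iff.2 ⟨x, ht⟩

theorem trace_pow_char (x : F) :
    Algebra.trace (ZMod p) F (x ^ p) = Algebra.trace (ZMod p) F x := by
  have := Algebra.trace_eq_of_algEquiv (FiniteField.frobeniusAlgEquivOfAlgebraic (ZMod p) F) x
  simpa [ZMod.card] using this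

variable (F p) in
theorem pow_char_bijective : Function.Bijective (fun x : F => x ^ p) := by
  simpa [ZMod.card] using (FiniteField.frobeniusAlgEquivOfAlgebraic (ZMod p) F).bijective

omit [IsDomain R] in
theorem gaussSum_pow_char (χ : MulChar F R) (ψ : AddChar (ZMod p) R) :
    gaussSum (χ ^ p) (traceChar F ψ) = gaussSum χ (traceChar F ψ) := by
  refine Fintype.sum_bijective _ (pow_char_bijective F p) _ _ fun x => ?_
  rw [MulChar.pow_apply' _ (Fact.out : p.Prime).ne_zero, traceChar_apply, traceChar_apply,
    trace_pow_char, map_pow]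

theorem gaussSum_pow_dvd_pow_digits_sum (χ : MulChar F R) {ψ : AddChar (ZMod p) R} (hψ : ψ ≠ 1)
    (a : ℕ) :
    gaussSum (χ ^ a) (traceChar F ψ) ∣ gaussSum χ (traceChar F ψ) ^ (p.digits a).sum := by
  have hp : 1 < p := (Fact.out : p.Prime).one_lt
  induction a using Nat.strong_induction_on with
  | _ a ih =>
    rcases Nat.eq_zero_or_pos a with rfl | ha
    · simp [gaussSum_one_left (traceChar_ne_one (F := F) hψ)]
    · have hsplit : χ ^ a = χ ^ (a % p) * (χ ^ (a / p)) ^ p := by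
        rw [← pow_mul, ← pow_add, mul_comm, Nat.mod_add_div]
      rw [Nat.digits_def' hp ha, List.sum_cons, pow_add, hsplit]
      refine (gaussSum_mul_dvd _ _ (traceChar_ne_one hψ)).trans (mul_dvd_mul ?_ ?_)
      · exact gaussSum_pow_dvd _ (traceChar_ne_one hψ) _
      · rw [gaussSum_pow_char]
        exact ih _ (Nat.div_lt_self ha hp)

end GaussSumDivisibility

section Teichmuller

variable {F R L : Type*} [Field F] [Fintype F] [CommRing R] [IsDomain R] [Field L]

theorem exists_teichmuller_mulChar (ρ : R →+* L) (θ : F →+* L)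
    (h : ∃ ξ : R, IsPrimitiveRoot ξ (Fintype.card F - 1)) :
    ∃ ω : MulChar F R, ∀ x, ρ (ω x) = θ x := by
  classical
  obtain ⟨ξ, hξ⟩ := h
  have hn : 0 < Fintype.card F - 1 := Nat.sub_pos_of_lt Fintype.one_lt_card
  obtain ⟨g, hg⟩ := IsCyclic.exists_generator (α := Fˣ)
  have hgn : (θ g) ^ (Fintype.card F - 1) = 1 := by
    rw [← map_pow, FiniteField.pow_card_sub_one_eq_one _ g.ne_zero, map_one]
  have hprod := congrArg (Polynomial.eval₂ ρ (θ g)) (Polynomial.X_pow_sub_one_eq_prod hn hξ)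
  rw [Polynomial.eval₂_finsetProd] at hprod
  simp only [Polynomial.eval₂_sub, Polynomial.eval₂_X_pow, Polynomial.eval₂_one,
    Polynomial.eval₂_X, Polynomial.eval₂_C, hgn, sub_self] at hprod
  obtain ⟨η, hη, hη0⟩ := Finset.prod_eq_zero_iff.1 hprod.symm
  have hηn : η ^ (Fintype.card F - 1) = 1 := (Polynomial.mem_nthRootsFinset hn _).1 hη
  have hηu : IsUnit η := IsUnit.of_pow_eq_one hηn hn.ne'
  have hmem : hηu.unit ∈ rootsOfUnity (Fintype.card Fˣ) R := by
    rw [mem_rootsOfUnity, Fintype.card_units]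
    ext
    simpa using hηn
  refine ⟨MulChar.ofRootOfUnity hmem hg, fun x => ?_⟩
  rcases eq_or_ne x 0 with rfl | hx
  · rw [MulChar.map_nonunit _ not_isUnit_zero, map_zero, map_zero]
  · obtain ⟨k, hk⟩ := Submonoid.mem_powers_iff _ _ |>.1
      (mem_powers_iff_mem_zpowers.2 (hg (Units.mk0 x hx)))
    have hxk : x = (g : F) ^ k := by
      rw [← Units.val_pow_eq_pow_val, hk, Units.val_mk0]
    rw [hxk, map_pow, map_pow, map_pow, MulChar.ofRootOfUnity_spec, IsUnit.unit_spec,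
      sub_eq_zero.1 hη0]

omit [IsDomain R] in
theorem orderOf_teichmuller {ρ : R →+* L} {θ : F →+* L} {ω : MulChar F R}
    (h : ∀ x, ρ (ω x) = θ x) : orderOf ω = Fintype.card F - 1 := by
  classical
  rw [← Fintype.card_units]
  refine Nat.dvd_antisymm (orderOf_dvd_of_pow_eq_one (by
    rw [MulChar.pow_card_eq_one])) ?_
  obtain ⟨g, hg⟩ := IsCyclic.exists_generator (α := Fˣ)
  rw [← Nat.card_eq_fintype_card, ← orderOf_eq_card_of_forall_mem_zpowers hg]
  apply orderOf_dvd_of_pow_eq_one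
  have h1 := congrArg (fun χ : MulChar F R => ρ (χ g)) (pow_orderOf_eq_one ω)
  simp only [MulChar.pow_apply_coe, map_pow, h, MulChar.one_apply_coe, map_one] at h1
  ext
  apply θ.injective
  simpa using h1

variable {p : ℕ} [Fact p.Prime] [Algebra (ZMod p) F]

theorem sum_inv_mul_trace (hp : 2 < Fintype.card F) :
    ∑ x : F, x⁻¹ * algebraMap (ZMod p) F (Algebra.trace (ZMod p) F x) = -1 := by
  classical
  have hpp : p.Prime := Fact.out
  have hcard : Fintype.card F = p ^ Module.finrank (ZMod p) F := by
    rw [Module.card_eq_pow_finrank (K := ZMod p), ZMod.card]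
  have hfin : 0 < Module.finrank (ZMod p) F := Module.finrank_pos
  have hunits : ∀ f : F → F, f 0 = 0 → ∑ x : F, f x = ∑ u : Fˣ, f u := by
    intro f hf
    rw [Fintype.sum_eq_add_sum_subtype_ne _ (0 : F), hf, zero_add]
    exact (Fintype.sum_equiv unitsEquivNeZero _ _ fun _ => rfl).symm
  rw [hunits _ (by simp)]
  simp only [FiniteField.algebraMap_trace_eq_sum_pow, Finset.mul_sum, Nat.card_zmod]
  rw [Finset.sum_comm, Finset.sum_eq_single_of_mem 0 (Finset.mem_range.2 hfin)]
  · have := FiniteField.sum_pow_units F 0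
    simpa using this
  · intro i hi hi0
    have h1 : ∀ u : Fˣ, (u : F)⁻¹ * (u : F) ^ p ^ i = (u : F) ^ (p ^ i - 1) := by
      intro u
      rw [pow_sub₀ _ u.ne_zero (Nat.one_le_pow _ _ hpp.pos), pow_one, mul_comm]
    simp only [h1]
    rw [FiniteField.sum_pow_units, if_neg]
    intro hdvd
    have hlt : p ^ i < p ^ Module.finrank (ZMod p) F :=
      Nat.pow_lt_pow_right hpp.one_lt (Finset.mem_range.1 hi)
    have h2 : 1 < p ^ i := Nat.one_lt_pow hi0 hpp.one_lt
    have := Nat.le_of_dvd (by omega) hdvd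
    omega

theorem exists_gaussSum_inv_teichmuller_eq [CharP L p] (hF : 2 < Fintype.card F)
    {ρ : R →+* L} {θ : F →+* L} {ω : MulChar F R}
    (h : ∀ x, ρ (ω x) = θ x) (ψ : AddChar (ZMod p) R) :
    ∃ s : R, gaussSum ω⁻¹ (traceChar F ψ) = (ψ 1 - 1) * s ∧ ρ s = -1 := by
  classical
  set ζ := ψ 1 with hζ
  have hψ : ∀ t : ZMod p, ψ t = ζ ^ t.val := by
    intro t
    rw [hζ, ← AddChar.map_nsmul_eq_pow]
    simp
  have hρζ : ρ ζ = 1 := by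
    have h1 : ζ ^ p = 1 := by rw [hζ, ← AddChar.map_nsmul_eq_pow]; simp
    have h2 : (ρ ζ - 1) ^ p = 0 := by
      rw [sub_pow_char, ← map_pow, h1]; simp
    exact sub_eq_zero.1 (pow_eq_zero_iff (Fact.out : p.Prime).ne_zero |>.1 h2)
  have hω : ω⁻¹ ≠ 1 := by
    rw [Ne, inv_eq_one, ← orderOf_eq_one_iff, orderOf_teichmuller h]
    omega
  refine ⟨∑ x : F, ω⁻¹ x * ∑ i ∈ Finset.range (Algebra.trace (ZMod p) F x).val, ζ ^ i, ?_, ?_⟩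
  · rw [Finset.mul_sum, ← sub_zero (gaussSum _ _), ← MulChar.sum_eq_zero_of_ne_one hω, gaussSum,
      ← Finset.sum_sub_distrib]
    refine Finset.sum_congr rfl fun x _ => ?_
    rw [traceChar_apply, hψ, ← mul_assoc, mul_comm (ζ - 1), mul_assoc, mul_geom_sum]
    ring
  · rw [map_sum]
    have hθ := congrArg θ (sum_inv_mul_trace (p := p) hF)
    rw [map_sum, map_neg, map_one] at hθ
    rw [← hθ]
    refine Finset.sum_congr rfl fun x _ => ?_
    rw [map_mul, map_mul, MulChar.inv_apply', h]
    congr 1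
    rw [map_sum]
    simp only [map_pow, hρζ, one_pow, Finset.sum_const, Finset.card_range, nsmul_eq_mul, mul_one]
    rw [← map_natCast (θ.comp (algebraMap (ZMod p) F)), ZMod.natCast_zmod_val, RingHom.comp_apply]

omit [Field F] [Fintype F] [Field L] [Algebra (ZMod p) F] in
theorem one_sub_pow_dvd_prime {ψ : AddChar (ZMod p) R} (hψ : ψ ≠ 1) :
    (ψ 1 - 1) ^ (p - 1) ∣ (p : R) := by
  have hpp : p.Prime := Fact.out
  have hne : ψ 1 ≠ 1 := (AddChar.zmod_char_ne_one_iff p ψ).1 hψ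
  have hpow : ψ 1 ^ p = 1 := by rw [← AddChar.map_nsmul_eq_pow]; simp
  have hprim : IsPrimitiveRoot (ψ 1) (p - 1 + 1) := by
    rw [Nat.sub_add_cancel hpp.one_le]
    exact IsPrimitiveRoot.iff_orderOf.2 (orderOf_eq_prime hpow hne)
  have hp : (p : R) = ((p - 1 : ℕ) : R) + 1 := by
    rw [← Nat.cast_add_one, Nat.sub_add_cancel hpp.one_le]
  rw [hp, ← hprim.prod_one_sub_pow_eq_order, ← Finset.card_range (p - 1), ← Finset.prod_const,
    Finset.card_range]
  exact Finset.prod_dvd_prod_of_dvd _ _ fun k _ =>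
    dvd_sub_comm.1 (sub_one_dvd_pow_sub_one _ _)

/-- The divisibility part of Stickelberger's theorem, at one prime above `p`. -/
theorem prime_pow_dvd_gaussSum_teichmuller_pow [CharP L p] (hF : 2 < Fintype.card F)
    (hpR : (p : R) ≠ 0) {ρ : R →+* L} [IsLocalHom ρ] {θ : F →+* L} {ω : MulChar F R}
    (h : ∀ x, ρ (ω x) = θ x) {ψ : AddChar (ZMod p) R} (hψ : ψ ≠ 1) {a f m : ℕ}
    (ha : 0 < a) (ha' : a < Fintype.card F - 1) (hf : Fintype.card F = p ^ (m + f))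
    (hm : (p.digits a).sum = (p - 1) * m) :
    (p : R) ^ f ∣ gaussSum (ω ^ a) (traceChar F ψ) := by
  obtain ⟨s, hs, hρs⟩ := exists_gaussSum_inv_teichmuller_eq hF h ψ
  have hsu : IsUnit s := isUnit_of_map_unit ρ s (by rw [hρs]; exact isUnit_one.neg)
  obtain ⟨c, hc⟩ := one_sub_pow_dvd_prime hψ
  have hne : ω ^ a ≠ 1 := by
    rw [Ne, ← orderOf_dvd_iff_pow_eq_one, orderOf_teichmuller h]
    exact Nat.not_dvd_of_pos_of_lt ha ha'
  have hq : (p : R) ^ (m + f) ∣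
      gaussSum (ω ^ a) (traceChar F ψ) * gaussSum (ω⁻¹ ^ a) (traceChar F ψ) := by
    refine ⟨(ω ^ a)⁻¹ (-1), ?_⟩
    rw [inv_pow, gaussSum_mul_gaussSum_inv hne (traceChar_ne_one hψ), hf, mul_comm]
    push_cast
    ring
  replace hq := hq.trans (mul_dvd_mul_left _ (gaussSum_pow_dvd_pow_digits_sum ω⁻¹ hψ a))
  rw [hs, hm, mul_pow, pow_mul] at hq
  replace hq := hq.trans (Dvd.intro (c ^ m) rfl)
  have hrw : gaussSum (ω ^ a) (traceChar F ψ) *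
      (((ψ 1 - 1) ^ (p - 1)) ^ m * s ^ ((p - 1) * m)) * c ^ m =
      (p : R) ^ m * (gaussSum (ω ^ a) (traceChar F ψ) * s ^ ((p - 1) * m)) := by
    rw [hc, mul_pow]
    ring
  rw [hrw, pow_add, mul_dvd_mul_iff_left (pow_ne_zero _ hpR)] at hq
  exact (hsu.pow _).dvd_mul_right.1 hq

end Teichmuller

section Periods

variable {F R : Type*} [Field F] [Fintype F] [CommRing R] [IsDomain R]
  {p : ℕ} [Fact p.Prime] [Algebra (ZMod p) F]

theorem exists_int_sum_traceChar_eq {ψ : AddChar (ZMod p) R} (hψ : ψ ≠ 1) (S : Finset F)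
    (hS : ∀ c : ZMod p, c ≠ 0 → ∀ x ∈ S, c • x ∈ S) :
    ∃ n : ℤ, ∑ x ∈ S, traceChar F ψ x = n := by
  classical
  set N : ZMod p → ℕ := fun t => (S.filter fun x => Algebra.trace (ZMod p) F x = t).card with hN
  have hmul : ∀ c t : ZMod p, c ≠ 0 → N t ≤ N (c * t) := by
    intro c t hc
    refine Finset.card_le_card_of_injOn (c • ·) (fun x hx => ?_)
      ((smul_right_injective F hc).injOn)
    simp only [Finset.coe_filter, Set.mem_ofPred_eq] at hx ⊢
    exact ⟨hS c hc x hx.1, by rw [map_smul, hx.2, smul_eq_mul]⟩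
  have hN1 : ∀ t : ZMod p, t ≠ 0 → N t = N 1 := fun t ht =>
    le_antisymm (by simpa [ht] using hmul t⁻¹ t (inv_ne_zero ht)) (by simpa using hmul t 1 ht)
  refine ⟨N 0 - N 1, ?_⟩
  have h1 : ∑ x ∈ S, traceChar F ψ x = ∑ t, (N t : R) * ψ t := by
    rw [← Finset.sum_fiberwise S (fun x => Algebra.trace (ZMod p) F x)]
    refine Finset.sum_congr rfl fun t _ => ?_
    rw [Finset.sum_congr rfl (g := fun _ => ψ t), Finset.sum_const, nsmul_eq_mul]
    intro x hx
    rw [traceChar_apply, (Finset.mem_filter.1 hx).2]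
  have h2 : ∑ t, ((N t : R) - N 1) * ψ t = N 0 - N 1 := by
    rw [Finset.sum_eq_single_of_mem 0 (Finset.mem_univ _), AddChar.map_zero_eq_one, mul_one]
    intro t _ ht
    rw [hN1 t ht, sub_self, zero_mul]
  simp only [sub_mul, Finset.sum_sub_distrib, ← Finset.mul_sum,
    AddChar.sum_eq_zero_of_ne_one hψ, mul_zero, sub_zero] at h2
  rw [h1, h2]
  push_cast
  ring

/-- The Gauss sums of the powers of a character of order `n` coprime to `p - 1` are the discrete
Fourier transform of integers which are constant on the orbits of multiplication by `p`. -/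
theorem exists_periods_gaussSum_pow_eq [CharZero R] {n : ℕ} (hn : 0 < n)
    (hcop : n.Coprime (p - 1)) {χ : MulChar F R} (hχ : χ ^ n = 1) {ζ : R}
    (hζ : IsPrimitiveRoot ζ n) {ψ : AddChar (ZMod p) R} (hψ : ψ ≠ 1) (hpn : n.Coprime p) :
    ∃ T : ℕ → ℤ, (∀ k, T (p * k) = T k) ∧ (∀ k, T (k + n) = T k) ∧
      ∀ j, gaussSum (χ ^ j) (traceChar F ψ) = ∑ k ∈ Finset.range n, T k * (ζ ^ j) ^ k := by
  classical
  have : NeZero n := ⟨hn.ne'⟩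
  have hroot : ∀ x : F, x ≠ 0 → χ x ^ n = 1 := fun x hx => by
    rw [← MulChar.pow_apply' _ hn.ne', hχ, MulChar.one_apply (isUnit_iff_ne_zero.2 hx)]
  have hscal : ∀ c : ZMod p, c ≠ 0 → χ (algebraMap (ZMod p) F c) = 1 := by
    intro c hc
    have h1 := hroot _ ((map_ne_zero (algebraMap (ZMod p) F)).2 hc)
    have h2 : χ (algebraMap (ZMod p) F c) ^ (p - 1) = 1 := by
      rw [← map_pow, ← map_pow, ZMod.pow_card_sub_one_eq_one hc, map_one, map_one]
    have h3 := pow_gcd_eq_one.2 ⟨h1, h2⟩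
    rwa [hcop, pow_one] at h3
  have hex : ∀ k : ℕ, ∃ t : ℤ, ∑ x with χ x = ζ ^ k, traceChar F ψ x = t := fun k => by
    refine exists_int_sum_traceChar_eq hψ _ fun c hc x hx => ?_
    rw [Finset.mem_filter] at hx ⊢
    exact ⟨Finset.mem_univ _, by rw [Algebra.smul_def, map_mul, hscal c hc, one_mul, hx.2]⟩
  choose T hT using hex
  refine ⟨T, fun k => ?_, fun k => ?_, fun j => ?_⟩
  · have hmod : ∀ i j : ℕ, ζ ^ i = ζ ^ j ↔ i ≡ j [MOD n] := fun i j => by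
      rw [hζ.eq_orderOf]
      exact (isOfFinOrder_iff_pow_eq_one.2 ⟨n, hn, hζ.pow_eq_one⟩).pow_eq_pow_iff_modEq
    have hinj : ∀ x : F, χ (x ^ p) = ζ ^ (p * k) ↔ χ x = ζ ^ k := by
      intro x
      refine ⟨fun h => ?_, fun h => by rw [map_pow, h, ← pow_mul, mul_comm]⟩
      have hx : x ≠ 0 := by
        rintro rfl
        rw [zero_pow (Fact.out : p.Prime).ne_zero, MulChar.map_nonunit _ not_isUnit_zero] at h
        exact pow_ne_zero _ (hζ.ne_zero hn.ne') h.symm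
      obtain ⟨i, -, hi⟩ := hζ.eq_pow_of_pow_eq_one (hroot x hx)
      rw [map_pow, ← hi, ← pow_mul, mul_comm, hmod] at h
      rw [← hi, hmod]
      exact Nat.ModEq.cancel_left_of_coprime hpn h
    have : (T (p * k) : R) = T k := by
      rw [← hT, ← hT, Finset.sum_filter, Finset.sum_filter]
      refine (Fintype.sum_bijective _ (pow_char_bijective F p) _ _ fun x => ?_).symm
      simp only [hinj, traceChar_apply, trace_pow_char]
    exact_mod_cast this
  · have : (T (k + n) : R) = T k := by
      rw [← hT, ← hT, pow_add, hζ.pow_eq_one, mul_one]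
    exact_mod_cast this
  · simp only [← hT, Finset.sum_filter, Finset.sum_mul]
    rw [Finset.sum_comm, gaussSum]
    refine Finset.sum_congr rfl fun x _ => ?_
    rcases eq_or_ne x 0 with rfl | hx
    · rw [MulChar.map_nonunit _ not_isUnit_zero, zero_mul, Finset.sum_eq_zero]
      intro k _
      rw [MulChar.map_nonunit _ not_isUnit_zero,
        if_neg (pow_ne_zero _ (hζ.ne_zero hn.ne')).symm, zero_mul]
    · obtain ⟨i, hi, hix⟩ := hζ.eq_pow_of_pow_eq_one (hroot x hx)
      rw [Finset.sum_eq_single_of_mem i (Finset.mem_range.2 hi), if_pos hix.symm]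
      · rw [← Units.val_mk0 hx, MulChar.pow_apply_coe, Units.val_mk0, ← hix, pow_right_comm,
          mul_comm]
      · intro k hk hki
        rw [if_neg, zero_mul]
        intro hk'
        exact hki (hζ.pow_inj (Finset.mem_range.1 hk) hi (hk'.symm.trans hix.symm))

end Periods

section PrimeAbove79

variable {R : Type*} [CommRing R] [IsDomain R] [CharZero R]

theorem intCast_pow_dvd {q : ℕ} (hq : q.Prime) (h : ¬ IsUnit (q : R)) (m : ℕ) (n : ℤ)
    (hn : (q : R) ^ m ∣ n) : (q : ℤ) ^ m ∣ n := by
  induction m generalizing n with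
  | zero => simp
  | succ m ih =>
    have hqn : (q : ℤ) ∣ n := by
      by_contra hc
      obtain ⟨u, v, huv⟩ := (Nat.prime_iff_prime_int.1 hq).coprime_iff_not_dvd.2 hc
      refine h (isUnit_of_dvd_one ?_)
      have h1 : (u : R) * q + v * n = 1 := by exact_mod_cast huv
      rw [← h1]
      exact dvd_add (dvd_mul_left _ _)
        (((dvd_pow_self _ m.succ_ne_zero).trans hn).mul_left _)
    obtain ⟨k, rfl⟩ := hqn
    rw [pow_succ'] at hn ⊢
    push_cast at hn
    exact mul_dvd_mul_left _ (ih k ((mul_dvd_mul_iff_left (by exact_mod_cast hq.ne_zero)).1 hn))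

omit [IsDomain R] in
theorem isUnit_intCast_of_isCoprime [IsLocalRing R] {q n : ℤ} (h : ¬ IsUnit (q : R))
    (hn : IsCoprime q n) : IsUnit (n : R) := by
  obtain ⟨u, v, huv⟩ := hn
  have h1 : (u : R) * q + v * n = 1 := by exact_mod_cast huv
  rcases IsLocalRing.isUnit_or_isUnit_of_add_one h1 with h2 | h2
  · exact absurd (isUnit_of_mul_isUnit_right h2) h
  · exact isUnit_of_mul_isUnit_right h2

omit [IsDomain R] [CharZero R] in
theorem dvd_or_dvd_of_isUnit_add [IsLocalRing R] {a b c : R} (h : a * b = c)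
    (hab : IsUnit (a + b)) : c ∣ a ∨ c ∣ b := by
  subst h
  rcases IsLocalRing.isUnit_or_isUnit_of_isUnit_add hab with ha | hb
  · exact Or.inr (ha.mul_left_dvd.2 dvd_rfl)
  · exact Or.inl (hb.mul_right_dvd.2 dvd_rfl)

/-- The units of the ring of integers of `ℚ(√5, √-7)` of relative norm one over `ℚ(√5)` are
`1` and `-1`; here `a + b p + c r + d p r` is such a unit, `p = (-1 + √5) / 2` and
`r = (-1 + √-7) / 2`. -/
theorem eq_one_or_neg_one_of_relNorm_eq_one {a b c d : ℤ}
    (h0 : a ^ 2 + b ^ 2 - (a * c + b * d) + 2 * (c ^ 2 + d ^ 2) = 1)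
    (h1 : 2 * a * b - b ^ 2 - (a * d + b * c - b * d) + 2 * (2 * c * d - d ^ 2) = 0) :
    (a = 1 ∨ a = -1) ∧ b = 0 ∧ c = 0 ∧ d = 0 := by
  have key : 2 * (2 * a - c) ^ 2 - 2 * (2 * a - c) * (2 * b - d) + 3 * (2 * b - d) ^ 2
      + 7 * (2 * c ^ 2 - 2 * c * d + 3 * d ^ 2) = 8 := by
    linear_combination 8 * h0 - 4 * h1
  have hd : d = 0 := by
    have : 35 * d ^ 2 ≤ 16 := by
      nlinarith [sq_nonneg (2 * a - c), sq_nonneg (2 * (2 * a - c) - (2 * b - d)),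
        sq_nonneg (2 * b - d), sq_nonneg (2 * c - d)]
    have h2 : d ^ 2 < 1 := by omega
    exact pow_eq_zero_iff two_ne_zero |>.1 (le_antisymm (by omega) (sq_nonneg d))
  subst hd
  have hc : c = 0 := by
    have : 14 * c ^ 2 ≤ 8 := by
      nlinarith [sq_nonneg (2 * (2 * a - c) - (2 * b)), sq_nonneg b]
    exact pow_eq_zero_iff two_ne_zero |>.1 (le_antisymm (by omega) (sq_nonneg c))
  subst hc
  have hb : b = 0 := by
    have : 5 * b ^ 2 ≤ 4 := by
      nlinarith [sq_nonneg (2 * a - b)]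
    exact pow_eq_zero_iff two_ne_zero |>.1 (le_antisymm (by omega) (sq_nonneg b))
  subst hb
  refine ⟨sq_eq_one_iff.1 ?_, rfl, rfl, rfl⟩
  linarith

theorem dvd_coeffs_of_dvd_conjugates {q : ℕ} (hq : q.Prime) (h : ¬ IsUnit (q : R))
    (hq35 : IsCoprime (q : ℤ) 35) {p r : R} (hp : p ^ 2 = 1 - p) (hr : r ^ 2 = -r - 2) {m : ℕ}
    {a b c d : ℤ}
    (h₁ : (q : R) ^ m ∣ a + b * p + c * r + d * p * r)
    (h₂ : (q : R) ^ m ∣ a + b * (-1 - p) + c * r + d * (-1 - p) * r)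
    (h₃ : (q : R) ^ m ∣ a + b * (-1 - p) + c * (-1 - r) + d * (-1 - p) * (-1 - r))
    (h₄ : (q : R) ^ m ∣ a + b * p + c * (-1 - r) + d * p * (-1 - r)) :
    (q : ℤ) ^ m ∣ a ∧ (q : ℤ) ^ m ∣ b ∧ (q : ℤ) ^ m ∣ c ∧ (q : ℤ) ^ m ∣ d := by
  obtain ⟨y₁, h₁⟩ := h₁
  obtain ⟨y₂, h₂⟩ := h₂
  obtain ⟨y₃, h₃⟩ := h₃
  obtain ⟨y₄, h₄⟩ := h₄
  have key : ∀ n : ℤ, (∃ y, ((2 * p + 1) ^ 2 * (2 * r + 1) ^ 2) * (n : R) = q ^ m * y) →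
      (q : ℤ) ^ m ∣ n := by
    rintro n ⟨y, hy⟩
    refine (hq35.pow_left (m := m)).dvd_of_dvd_mul_left (intCast_pow_dvd hq h m _ ⟨-y, ?_⟩)
    push_cast
    linear_combination -hy + 4 * n * (2 * r + 1) ^ 2 * hp + 4 * 5 * n * hr
  refine ⟨key a ⟨(2 * p + 1) * (2 * r + 1) *
      (p * (r * y₃ - (-1 - r) * y₂) - (-1 - p) * (r * y₄ - (-1 - r) * y₁)), ?_⟩,
    key b ⟨(2 * p + 1) * (2 * r + 1) * (r * (y₄ - y₃) - (-1 - r) * (y₁ - y₂)), ?_⟩,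
    key c ⟨(2 * p + 1) * (2 * r + 1) * (p * (y₂ - y₃) - (-1 - p) * (y₁ - y₄)), ?_⟩,
    key d ⟨(2 * p + 1) * (2 * r + 1) * (y₁ - y₂ - y₄ + y₃), ?_⟩⟩
  · linear_combination (2 * p + 1) * (2 * r + 1) *
      (p * (r * h₃ - (-1 - r) * h₂) - (-1 - p) * (r * h₄ - (-1 - r) * h₁))
  · linear_combination (2 * p + 1) * (2 * r + 1) * (r * (h₄ - h₃) - (-1 - r) * (h₁ - h₂))
  · linear_combination (2 * p + 1) * (2 * r + 1) * (p * (h₂ - h₃) - (-1 - p) * (h₁ - h₄))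
  · linear_combination (2 * p + 1) * (2 * r + 1) * (h₁ - h₂ - h₄ + h₃)

theorem eq_one_or_neg_one_of_mul_conj_eq {p r N : R} (hN : N ≠ 0) (hp : p ^ 2 = 1 - p)
    (hr : r ^ 2 = -r - 2) {a b c d : ℤ}
    (h : (N * (a + b * p + c * r + d * p * r)) *
      (N * (a + b * p + c * (-1 - r) + d * p * (-1 - r))) = N ^ 2)
    (h' : (N * (a + b * (-1 - p) + c * r + d * (-1 - p) * r)) *
      (N * (a + b * (-1 - p) + c * (-1 - r) + d * (-1 - p) * (-1 - r))) = N ^ 2) :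
    (a = 1 ∨ a = -1) ∧ b = 0 ∧ c = 0 ∧ d = 0 := by
  set e₀ := a ^ 2 + b ^ 2 - (a * c + b * d) + 2 * (c ^ 2 + d ^ 2) with he₀
  set e₁ := 2 * a * b - b ^ 2 - (a * d + b * c - b * d) + 2 * (2 * c * d - d ^ 2) with he₁
  have hnorm : ∀ p : R, p ^ 2 = 1 - p → (a + b * p + c * r + d * p * r) *
      (a + b * p + c * (-1 - r) + d * p * (-1 - r)) = e₀ + e₁ * p := by
    intro p hp
    rw [he₀, he₁]
    push_cast
    clear * - hp hr
    grind
  have hE : (e₀ : R) + e₁ * p = 1 := mul_left_cancel₀ (pow_ne_zero 2 hN)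
    (by linear_combination h - N ^ 2 * hnorm p hp)
  have hE' : (e₀ : R) + e₁ * (-1 - p) = 1 := mul_left_cancel₀ (pow_ne_zero 2 hN)
    (by linear_combination h' - N ^ 2 * hnorm (-1 - p) (by linear_combination hp))
  have h5 : ((5 * e₁ : ℤ) : R) = 0 := by
    push_cast
    linear_combination (2 * p + 1) * (hE - hE') - 4 * e₁ * hp
  have he₁' : e₁ = 0 := by
    have : 5 * e₁ = 0 := by exact_mod_cast h5
    omega
  have he₀' : e₀ = 1 := by
    rw [he₁', Int.cast_zero, zero_mul, add_zero] at hE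
    exact_mod_cast hE
  exact eq_one_or_neg_one_of_relNorm_eq_one he₀' he₁'

theorem eq_of_prime_above_dvd (h : ¬ IsUnit (79 : R)) {p r : R} (hp : p ^ 2 = 1 - p)
    (hr : r ^ 2 = -r - 2) {A B C D : ℤ} {g₁ g₂ g₃ g₄ : R}
    (hg₁ : g₁ = A + B * p + C * r + D * p * r)
    (hg₂ : g₂ = A + B * (-1 - p) + C * r + D * (-1 - p) * r)
    (hg₃ : g₃ = A + B * (-1 - p) + C * (-1 - r) + D * (-1 - p) * (-1 - r))
    (hg₄ : g₄ = A + B * p + C * (-1 - r) + D * p * (-1 - r))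
    (hd₁ : 79 ^ 4 ∣ g₁) (hd₂ : 79 ^ 3 ∣ g₂) (hd₃ : 79 ^ 3 ∣ g₃) (hd₄ : 79 ^ 2 ∣ g₄)
    (h₁₄ : g₁ * g₄ = 79 ^ 6) (h₂₃ : g₂ * g₃ = 79 ^ 6)
    (hAC : 7 ∣ A + 3 * C - 79 ^ 3)
    (hdr : 79 ∣ 7 + 6 * r) (hdpr : 79 ∣ -1 - 3 * p - 3 * r - 6 * p * r) :
    A = 79 ^ 2 * 29 ∧ B = 79 ^ 2 * 51 ∧ C = -(79 ^ 2 * 9) ∧ D = -(79 ^ 2 * 24) := by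
  have h79 : ((79 : ℕ) : R) = 79 := by norm_num
  set a := 38 * A + 75 * B - 18 * C - 48 * D with ha
  set b := 75 * A - 37 * B - 48 * C + 30 * D with hb
  set c := 9 * A + 24 * B + 29 * C + 51 * D with hc
  set d := 24 * A - 15 * B + 51 * C - 22 * D with hd
  have hx₁ : g₁ * ((1 - 6 * r) * (2 + 3 * p + 3 * r + 6 * p * r)) =
      a + b * p + c * r + d * p * r := by
    rw [hg₁, ha, hb, hc, hd]; push_cast; clear * - hp hr; grind
  have hx₂ : g₂ * ((1 - 6 * r) * (-1 - 3 * p - 3 * r - 6 * p * r)) =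
      a + b * (-1 - p) + c * r + d * (-1 - p) * r := by
    rw [hg₂, ha, hb, hc, hd]; push_cast; clear * - hp hr; grind
  have hx₃ : g₃ * ((7 + 6 * r) * (2 + 3 * p + 3 * r + 6 * p * r)) =
      a + b * (-1 - p) + c * (-1 - r) + d * (-1 - p) * (-1 - r) := by
    rw [hg₃, ha, hb, hc, hd]; push_cast; clear * - hp hr; grind
  have hx₄ : g₄ * ((7 + 6 * r) * (-1 - 3 * p - 3 * r - 6 * p * r)) =
      a + b * p + c * (-1 - r) + d * p * (-1 - r) := by
    rw [hg₄, ha, hb, hc, hd]; push_cast; clear * - hp hr; grind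
  have hN : (1 - 6 * r) * (7 + 6 * r) = 79 := by clear * - hp hr; grind
  have hN' : (2 + 3 * p + 3 * r + 6 * p * r) * (-1 - 3 * p - 3 * r - 6 * p * r) = 79 := by
    clear * - hp hr; grind
  have hprod : (a + b * p + c * r + d * p * r) * (a + b * p + c * (-1 - r) + d * p * (-1 - r)) =
      (79 : R) ^ 8 := by
    rw [← hx₁, ← hx₄]
    linear_combination ((1 - 6 * r) * (7 + 6 * r)) * ((2 + 3 * p + 3 * r + 6 * p * r) *
      (-1 - 3 * p - 3 * r - 6 * p * r)) * h₁₄ + 79 ^ 6 * ((2 + 3 * p + 3 * r + 6 * p * r) *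
      (-1 - 3 * p - 3 * r - 6 * p * r)) * hN + 79 ^ 7 * hN'
  have hprod' : (a + b * (-1 - p) + c * r + d * (-1 - p) * r) *
      (a + b * (-1 - p) + c * (-1 - r) + d * (-1 - p) * (-1 - r)) = (79 : R) ^ 8 := by
    rw [← hx₂, ← hx₃]
    linear_combination ((1 - 6 * r) * (7 + 6 * r)) * ((2 + 3 * p + 3 * r + 6 * p * r) *
      (-1 - 3 * p - 3 * r - 6 * p * r)) * h₂₃ + 79 ^ 6 * ((2 + 3 * p + 3 * r + 6 * p * r) *
      (-1 - 3 * p - 3 * r - 6 * p * r)) * hN + 79 ^ 7 * hN'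
  have hdvd := dvd_coeffs_of_dvd_conjugates (q := 79) (m := 4) (by norm_num) (by rwa [h79])
    (by norm_num) hp hr
    (by rw [← hx₁, h79]; exact hd₁.mul_right _)
    (by rw [← hx₂, h79, pow_succ]; exact mul_dvd_mul hd₂ (hdpr.mul_left _))
    (by rw [← hx₃, h79, pow_succ]; exact mul_dvd_mul hd₃ (hdr.mul_right _))
    (by
      rw [← hx₄, h79, show (79 : R) ^ 4 = 79 ^ 2 * (79 * 79) by ring]
      exact mul_dvd_mul hd₄ (mul_dvd_mul hdr hdpr))
  clear_value a b c d
  obtain ⟨⟨a, rfl⟩, ⟨b, rfl⟩, ⟨c, rfl⟩, ⟨d, rfl⟩⟩ := hdvd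
  push_cast at hprod hprod' ha hb hc hd
  obtain ⟨ha', rfl, rfl, rfl⟩ := eq_one_or_neg_one_of_mul_conj_eq (N := (79 : R) ^ 4) (a := a)
    (b := b) (c := c) (d := d) (by norm_num) hp hr
    (by linear_combination hprod) (by linear_combination hprod')
  clear hprod hprod' hx₁ hx₂ hx₃ hx₄ hg₁ hg₂ hg₃ hg₄
  have hA : A = 29 * 79 ^ 2 * a := by linarith
  have hB : B = 51 * 79 ^ 2 * a := by linarith
  have hC : C = -9 * 79 ^ 2 * a := by linarith
  have hD : D = -24 * 79 ^ 2 * a := by linarith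
  rcases ha' with rfl | rfl
  · rw [hA, hB, hC, hD]
    norm_num
  · rw [hA, hC] at hAC
    norm_num at hAC

theorem exists_sqrt_five_sqrt_neg_seven [IsLocalRing R] (h : ¬ IsUnit (79 : R)) {p r : R}
    (hp : p ^ 2 = 1 - p) (hr : r ^ 2 = -r - 2) {A B C D : ℤ} {g₁ g₂ g₃ g₄ : R}
    (hg₁ : g₁ = A + B * p + C * r + D * p * r)
    (hg₂ : g₂ = A + B * (-1 - p) + C * r + D * (-1 - p) * r)
    (hg₃ : g₃ = A + B * (-1 - p) + C * (-1 - r) + D * (-1 - p) * (-1 - r))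
    (hg₄ : g₄ = A + B * p + C * (-1 - r) + D * p * (-1 - r))
    (hd₁ : 79 ^ 4 ∣ g₁) (hd₂ : 79 ^ 3 ∣ g₂) (hd₃ : 79 ^ 3 ∣ g₃) (hd₄ : 79 ^ 2 ∣ g₄)
    (h₁₄ : g₁ * g₄ = 79 ^ 6) (h₂₃ : g₂ * g₃ = 79 ^ 6)
    (hAC : 7 ∣ A + 3 * C - 79 ^ 3) (hBD : 7 ∣ B + 3 * D) :
    ∃ s t : R, s ^ 2 = 5 ∧ t ^ 2 = -7 ∧
      2 * g₁ = 79 ^ 2 * (1 - 3 * (s * t)) * (4 + 3 * t) ∧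
      2 * g₂ = 79 ^ 2 * (1 + 3 * (s * t)) * (4 + 3 * t) ∧
      2 * g₃ = 79 ^ 2 * (1 - 3 * (s * t)) * (4 - 3 * t) ∧
      2 * g₄ = 79 ^ 2 * (1 + 3 * (s * t)) * (4 - 3 * t) := by
  have hdvd₁ : (79 : R) ∣ 1 - 6 * r ∨ (79 : R) ∣ 7 + 6 * r := by
    refine dvd_or_dvd_of_isUnit_add (by linear_combination -36 * hr) ?_
    have h8 := isUnit_intCast_of_isCoprime (R := R) (q := 79) (n := 8)
      (by exact_mod_cast h) (by norm_num)
    convert h8 using 1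
    push_cast
    ring
  wlog hdr : (79 : R) ∣ 7 + 6 * r generalizing r A B C D
  · refine this (r := -1 - r) (A := A - C) (B := B - D) (C := -C) (D := -D)
      (by linear_combination hr) ?_ ?_ ?_ ?_ (by omega) (by omega) ?_ ?_
    · rw [hg₁]; push_cast; ring
    · rw [hg₂]; push_cast; ring
    · rw [hg₃]; push_cast; ring
    · rw [hg₄]; push_cast; ring
    · rw [show 1 - 6 * (-1 - r) = 7 + 6 * r by ring, show 7 + 6 * (-1 - r) = 1 - 6 * r by ring]
      exact hdvd₁.symm
    · rw [show 7 + 6 * (-1 - r) = 1 - 6 * r by ring]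
      exact hdvd₁.resolve_right hdr
  clear hdvd₁
  have hdvd₂ : (79 : R) ∣ 2 + 3 * p + 3 * r + 6 * p * r ∨
      (79 : R) ∣ -1 - 3 * p - 3 * r - 6 * p * r := by
    refine dvd_or_dvd_of_isUnit_add (by clear * - hp hr; grind) ?_
    convert isUnit_one (M := R) using 1
    ring
  wlog hdpr : (79 : R) ∣ -1 - 3 * p - 3 * r - 6 * p * r generalizing p A B C D
  · refine this (p := -1 - p) (A := A - B) (B := -B) (C := C - D) (D := -D)
      (by linear_combination hp) ?_ ?_ ?_ ?_ (by omega) (by omega) ?_ ?_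
    · rw [hg₁]; push_cast; ring
    · rw [hg₂]; push_cast; ring
    · rw [hg₃]; push_cast; ring
    · rw [hg₄]; push_cast; ring
    · convert hdvd₂.symm using 2 <;> ring
    · convert hdvd₂.resolve_right hdpr using 1
      ring
  obtain ⟨rfl, rfl, rfl, rfl⟩ := eq_of_prime_above_dvd h hp hr hg₁ hg₂ hg₃ hg₄ hd₁ hd₂ hd₃ hd₄
    h₁₄ h₂₃ hAC hdr hdpr
  refine ⟨2 * p + 1, 2 * r + 1, by linear_combination 4 * hp, by linear_combination 4 * hr,
    ?_, ?_, ?_, ?_⟩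
  · rw [hg₁]; push_cast; clear * - hp hr; grind
  · rw [hg₂]; push_cast; clear * - hp hr; grind
  · rw [hg₃]; push_cast; clear * - hp hr; grind
  · rw [hg₄]; push_cast; clear * - hp hr; grind

omit [IsDomain R] [CharZero R] in
theorem sum_periods_eq {T : ℕ → ℤ} (hT : ∀ k, T (79 * k) = T k) (hT' : ∀ k, T (k + 35) = T k)
    {z : R} (hz : z ^ 35 = 1) :
    ∑ k ∈ Finset.range 35, (T k : R) * z ^ k = T 0 + T 7 * (z ^ 7 + z ^ 28) +
      T 14 * (z ^ 14 + z ^ 21) + T 5 * (z ^ 5 + z ^ 10 + z ^ 20) +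
      T 15 * (z ^ 15 + z ^ 30 + z ^ 25) +
      T 1 * ((z ^ 14 + z ^ 21) * (z ^ 15 + z ^ 30 + z ^ 25)) +
      T 2 * ((z ^ 7 + z ^ 28) * (z ^ 15 + z ^ 30 + z ^ 25)) +
      T 3 * ((z ^ 7 + z ^ 28) * (z ^ 5 + z ^ 10 + z ^ 20)) +
      T 34 * ((z ^ 14 + z ^ 21) * (z ^ 5 + z ^ 10 + z ^ 20)) := by
  have hmod : ∀ k, T (79 * k % 35) = T k := fun k => by
    rw [Function.Periodic.map_mod_nat hT', hT]
  have h₁ : T 9 = T 1 ∧ T 11 = T 1 ∧ T 29 = T 1 ∧ T 16 = T 1 ∧ T 4 = T 1 :=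
    ⟨hmod 1, (hmod 9).trans (hmod 1), (hmod 11).trans ((hmod 9).trans (hmod 1)),
      (hmod 29).trans ((hmod 11).trans ((hmod 9).trans (hmod 1))), (hmod 4).symm⟩
  have h₂ : T 18 = T 2 ∧ T 22 = T 2 ∧ T 23 = T 2 ∧ T 32 = T 2 ∧ T 8 = T 2 :=
    ⟨hmod 2, (hmod 18).trans (hmod 2), (hmod 22).trans ((hmod 18).trans (hmod 2)),
      (hmod 23).trans ((hmod 22).trans ((hmod 18).trans (hmod 2))), (hmod 8).symm⟩
  have h₃ : T 27 = T 3 ∧ T 33 = T 3 ∧ T 17 = T 3 ∧ T 13 = T 3 ∧ T 12 = T 3 :=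
    ⟨hmod 3, (hmod 27).trans (hmod 3), (hmod 33).trans ((hmod 27).trans (hmod 3)),
      (hmod 17).trans ((hmod 33).trans ((hmod 27).trans (hmod 3))), (hmod 12).symm⟩
  have h₄ : T 26 = T 34 ∧ T 24 = T 34 ∧ T 6 = T 34 ∧ T 19 = T 34 ∧ T 31 = T 34 :=
    ⟨hmod 34, (hmod 26).trans (hmod 34), (hmod 24).trans ((hmod 26).trans (hmod 34)),
      (hmod 6).trans ((hmod 24).trans ((hmod 26).trans (hmod 34))), (hmod 31).symm⟩
  have h₅ : T 10 = T 5 ∧ T 20 = T 5 ∧ T 30 = T 15 ∧ T 25 = T 15 ∧ T 28 = T 7 ∧ T 21 = T 14 :=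
    ⟨hmod 5, (hmod 20).symm, hmod 15, (hmod 25).symm, hmod 7, hmod 14⟩
  simp only [Finset.sum_range_succ, Finset.sum_range_zero, h₁, h₂, h₃, h₄, h₅]
  generalize (T 0 : R) = t₀, (T 7 : R) = t₇, (T 14 : R) = t₁₄, (T 5 : R) = t₅, (T 15 : R) = t₁₅,
    (T 1 : R) = t₁, (T 2 : R) = t₂, (T 3 : R) = t₃, (T 34 : R) = t₃₄
  linear_combination (-t₁ * (z ^ 9 + z ^ 4 + z + z ^ 16 + z ^ 11)
    - t₂ * (z ^ 2 + z ^ 8 + z ^ 23 + z ^ 18)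
    - t₃ * (z ^ 3 + z ^ 13) - t₃₄ * z ^ 6) * hz

omit [IsDomain R] in
/-- An integer of `ℚ(√5)` whose conjugates are both `± N` is rational, unless `5` divides
`N ^ 2`. -/
theorem eq_zero_of_sq_eq_sq {p : R} (hp : p ^ 2 = 1 - p) {E F N : ℤ} (hN : ¬ 5 ∣ N ^ 2)
    (h : (E + F * p) ^ 2 = (N : R) ^ 2) (h' : (E + F * (-1 - p)) ^ 2 = (N : R) ^ 2) :
    F = 0 ∧ (E = N ∨ E = -N) := by
  have h₁ : F * (2 * E - F) = 0 := by
    have : ((5 * (F * (2 * E - F)) : ℤ) : R) = 0 := by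
      push_cast
      linear_combination (2 * p + 1) * (h - h') - 4 * F * (2 * E - F) * hp
    have : 5 * (F * (2 * E - F)) = 0 := by exact_mod_cast this
    omega
  have h₂ : E ^ 2 + F ^ 2 = N ^ 2 := by
    have h₁' : (F : R) * (2 * E - F) = 0 := by exact_mod_cast h₁
    have : (E : R) ^ 2 + F ^ 2 = N ^ 2 := by
      linear_combination h - p * h₁' - F ^ 2 * hp
    exact_mod_cast this
  rcases mul_eq_zero.1 h₁ with rfl | h₃
  · exact ⟨rfl, sq_eq_sq_iff_eq_or_eq_neg.1 (by linarith)⟩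
  · refine absurd ⟨E ^ 2, ?_⟩ hN
    rw [← h₂, ← sub_eq_zero.1 h₃]
    ring

theorem exists_eq_of_periods [IsLocalRing R] (h : ¬ IsUnit (79 : R)) {ζ : R}
    (hζ : IsPrimitiveRoot ζ 35) {T : ℕ → ℤ} (hT : ∀ k, T (79 * k) = T k)
    (hT' : ∀ k, T (k + 35) = T k) {g : ℕ → R}
    (hg : ∀ j, g j = ∑ k ∈ Finset.range 35, T k * (ζ ^ j) ^ k)
    (hd₁ : 79 ^ 4 ∣ g 1) (hd₂ : 79 ^ 3 ∣ g 2) (hd₃ : 79 ^ 3 ∣ g 3) (hd₄ : 79 ^ 2 ∣ g 34)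
    (h₀ : g 0 = -1) (h₁₄ : g 1 * g 34 = 79 ^ 6) (h₂₃ : g 2 * g 3 = 79 ^ 6)
    (h₇ : g 7 ^ 2 = 79 ^ 6) (h₇' : g 14 ^ 2 = 79 ^ 6) :
    ∃ s t : R, s ^ 2 = 5 ∧ t ^ 2 = -7 ∧
      2 * g 1 = 79 ^ 2 * (1 - 3 * (s * t)) * (4 + 3 * t) ∧
      2 * g 2 = 79 ^ 2 * (1 + 3 * (s * t)) * (4 + 3 * t) ∧
      2 * g 3 = 79 ^ 2 * (1 - 3 * (s * t)) * (4 - 3 * t) ∧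
      2 * g 34 = 79 ^ 2 * (1 + 3 * (s * t)) * (4 - 3 * t) := by
  have hζ35 := hζ.pow_eq_one
  have hred : ∀ i j : ℕ, (ζ ^ i) ^ j = ζ ^ (i * j % 35) := fun i j => by
    rw [← pow_mul, hζ.eq_orderOf, pow_mod_orderOf]
  have h5 : 1 + ζ ^ 7 + ζ ^ 14 + ζ ^ 21 + ζ ^ 28 = 0 := by
    have := (hζ.pow (by norm_num) (show 35 = 7 * 5 by norm_num)).geom_sum_eq_zero (by norm_num)
    simpa only [Finset.sum_range_succ, Finset.sum_range_zero, hred, Nat.reduceMul, Nat.reduceMod,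
      pow_zero, zero_add] using this
  have h7 : 1 + ζ ^ 5 + ζ ^ 10 + ζ ^ 15 + ζ ^ 20 + ζ ^ 25 + ζ ^ 30 = 0 := by
    have := (hζ.pow (by norm_num) (show 35 = 5 * 7 by norm_num)).geom_sum_eq_zero (by norm_num)
    simpa only [Finset.sum_range_succ, Finset.sum_range_zero, hred, Nat.reduceMul, Nat.reduceMod,
      pow_zero, zero_add] using this
  have hgz : ∀ (j : ℕ) (p p' r r' : R), (ζ ^ j) ^ 7 + (ζ ^ j) ^ 28 = p →
      (ζ ^ j) ^ 14 + (ζ ^ j) ^ 21 = p' → (ζ ^ j) ^ 5 + (ζ ^ j) ^ 10 + (ζ ^ j) ^ 20 = r →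
      (ζ ^ j) ^ 15 + (ζ ^ j) ^ 30 + (ζ ^ j) ^ 25 = r' →
      g j = T 0 + T 7 * p + T 14 * p' + T 5 * r + T 15 * r' + T 1 * (p' * r') + T 2 * (p * r') +
        T 3 * (p * r) + T 34 * (p' * r) := by
    rintro j _ _ _ _ rfl rfl rfl rfl
    rw [hg, sum_periods_eq hT hT' (by rw [pow_right_comm, hζ35, one_pow])]
  obtain ⟨p, hp⟩ : ∃ p, p = ζ ^ 7 + ζ ^ 28 := ⟨_, rfl⟩
  obtain ⟨r, hr⟩ : ∃ r, r = ζ ^ 5 + ζ ^ 10 + ζ ^ 20 := ⟨_, rfl⟩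
  have hg₀ := hgz 0 2 2 3 3 (by norm_num) (by norm_num) (by norm_num) (by norm_num)
  have hg₁ := hgz 1 p (-1 - p) r (-1 - r)
    (by simp only [hred, Nat.reduceMul, Nat.reduceMod]; linear_combination -hp)
    (by simp only [hred, Nat.reduceMul, Nat.reduceMod]; linear_combination hp + h5)
    (by simp only [hred, Nat.reduceMul, Nat.reduceMod]; linear_combination -hr)
    (by simp only [hred, Nat.reduceMul, Nat.reduceMod]; linear_combination hr + h7)
  have hg₂ := hgz 2 (-1 - p) p r (-1 - r)
    (by simp only [hred, Nat.reduceMul, Nat.reduceMod]; linear_combination hp + h5)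
    (by simp only [hred, Nat.reduceMul, Nat.reduceMod]; linear_combination -hp)
    (by simp only [hred, Nat.reduceMul, Nat.reduceMod]; linear_combination -hr)
    (by simp only [hred, Nat.reduceMul, Nat.reduceMod]; linear_combination hr + h7)
  have hg₃ := hgz 3 (-1 - p) p (-1 - r) r
    (by simp only [hred, Nat.reduceMul, Nat.reduceMod]; linear_combination hp + h5)
    (by simp only [hred, Nat.reduceMul, Nat.reduceMod]; linear_combination -hp)
    (by simp only [hred, Nat.reduceMul, Nat.reduceMod]; linear_combination hr + h7)
    (by simp only [hred, Nat.reduceMul, Nat.reduceMod]; linear_combination -hr)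
  have hg₄ := hgz 34 p (-1 - p) (-1 - r) r
    (by simp only [hred, Nat.reduceMul, Nat.reduceMod]; linear_combination -hp)
    (by simp only [hred, Nat.reduceMul, Nat.reduceMod]; linear_combination hp + h5)
    (by simp only [hred, Nat.reduceMul, Nat.reduceMod]; linear_combination hr + h7)
    (by simp only [hred, Nat.reduceMul, Nat.reduceMod]; linear_combination -hr)
  have hg₇ := hgz 7 (-1 - p) p 3 3
    (by simp only [hred, Nat.reduceMul, Nat.reduceMod]; linear_combination hp + h5)
    (by simp only [hred, Nat.reduceMul, Nat.reduceMod]; linear_combination -hp)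
    (by simp only [hred, Nat.reduceMul, Nat.reduceMod]; ring)
    (by simp only [hred, Nat.reduceMul, Nat.reduceMod]; ring)
  have hg₁₄ := hgz 14 p (-1 - p) 3 3
    (by simp only [hred, Nat.reduceMul, Nat.reduceMod]; linear_combination -hp)
    (by simp only [hred, Nat.reduceMul, Nat.reduceMod]; linear_combination hp + h5)
    (by simp only [hred, Nat.reduceMul, Nat.reduceMod]; ring)
    (by simp only [hred, Nat.reduceMul, Nat.reduceMod]; ring)
  have hp2 : p ^ 2 = 1 - p := by
    rw [hp]
    linear_combination h5 + (2 + ζ ^ 21) * hζ35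
  have hr2 : r ^ 2 = -r - 2 := by
    rw [hr]
    linear_combination 2 * h7 + ζ ^ 5 * hζ35
  obtain ⟨hF, hE⟩ := eq_zero_of_sq_eq_sq hp2 (N := 79 ^ 3)
    (E := T 0 + 3 * T 5 + 3 * T 15 - T 14 - 3 * T 1 - 3 * T 34)
    (F := T 7 + 3 * T 2 + 3 * T 3 - T 14 - 3 * T 1 - 3 * T 34) (by norm_num)
    (by
      rw [hg₁₄] at h₇'
      push_cast
      linear_combination h₇')
    (by
      rw [hg₇] at h₇
      push_cast
      linear_combination h₇)
  have h₀' : T 0 + 2 * T 7 + 2 * T 14 + 3 * T 5 + 3 * T 15 +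
      6 * (T 1 + T 2 + T 3 + T 34) = -1 := by
    have : (T 0 + 2 * T 7 + 2 * T 14 + 3 * T 5 + 3 * T 15 +
        6 * (T 1 + T 2 + T 3 + T 34) : R) = -1 := by
      rw [← h₀, hg₀]
      ring
    exact_mod_cast this
  refine exists_sqrt_five_sqrt_neg_seven h hp2 hr2 (A := T 0 - T 14 - T 15 + T 1)
    (B := T 7 - T 14 + T 1 - T 2) (C := T 5 - T 15 + T 1 - T 34) (D := T 1 - T 2 + T 3 - T 34)
    ?_ ?_ ?_ ?_ hd₁ hd₂ hd₃ hd₄ h₁₄ h₂₃ (by omega) (by omega)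
  · rw [hg₁]; push_cast; ring
  · rw [hg₂]; push_cast; ring
  · rw [hg₃]; push_cast; ring
  · rw [hg₄]; push_cast; ring

end PrimeAbove79

theorem MulChar.apply_neg_one_of_odd_pow_eq_one {F R : Type*} [CommRing F] [CommRing R]
    {χ : MulChar F R} {n : ℕ} (hn : Odd n) (hχ : χ ^ n = 1) : χ (-1) = 1 := by
  obtain ⟨k, rfl⟩ := hn
  have h1 : χ (-1) ^ 2 = 1 := by rw [← map_pow, neg_one_sq, map_one]
  have h2 : χ (-1) ^ (2 * k + 1) = 1 := by
    rw [← MulChar.pow_apply' _ (by omega), hχ,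
      MulChar.one_apply (isUnit_one.neg)]
  rwa [pow_succ, pow_mul, h1, one_pow, one_mul] at h2

theorem exists_gaussSum_order_35 {F R : Type*} [Field F] [Fintype F] [Fact (Nat.Prime 79)]
    [Algebra (ZMod 79) F] (hcard : Fintype.card F = 79 ^ 6) [CommRing R] [IsDomain R]
    [CharZero R] [IsLocalRing R]
    (h : ¬ IsUnit (79 : R)) {ξ : R} (hξ : IsPrimitiveRoot ξ (Fintype.card F - 1))
    {ψ : AddChar (ZMod 79) R} (hψ : ψ ≠ 1) :
    ∃ χ : MulChar F R, orderOf χ = 35 ∧ ∃ s t : R, s ^ 2 = 5 ∧ t ^ 2 = -7 ∧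
      2 * gaussSum χ (traceChar F ψ) = 79 ^ 2 * (1 - 3 * (s * t)) * (4 + 3 * t) ∧
      2 * gaussSum (χ ^ 2) (traceChar F ψ) = 79 ^ 2 * (1 + 3 * (s * t)) * (4 + 3 * t) ∧
      2 * gaussSum (χ ^ 3) (traceChar F ψ) = 79 ^ 2 * (1 - 3 * (s * t)) * (4 - 3 * t) ∧
      2 * gaussSum (χ ^ 34) (traceChar F ψ) = 79 ^ 2 * (1 + 3 * (s * t)) * (4 - 3 * t) := by
  have hprime : Nat.Prime 79 := Fact.out
  let L := AlgebraicClosure (IsLocalRing.ResidueField R)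
  let ρ : R →+* L := (algebraMap (IsLocalRing.ResidueField R) L).comp (IsLocalRing.residue R)
  have : IsLocalHom ρ := RingHom.isLocalHom_comp _ _
  have hL : ((79 : ℕ) : L) = 0 := by
    by_contra hne
    refine h (isUnit_of_map_unit ρ 79 (isUnit_iff_ne_zero.2 ?_))
    rw [map_ofNat]
    exact_mod_cast hne
  have : CharP L 79 := ringChar.of_eq (CharP.ringChar_of_prime_eq_zero hprime hL)
  let : Algebra (ZMod 79) L := ZMod.algebra L 79
  let θ : F →+* L := (IsAlgClosed.lift : F →ₐ[ZMod 79] L)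
  obtain ⟨ω, hω⟩ := exists_teichmuller_mulChar ρ θ ⟨ξ, hξ⟩
  have hord : orderOf (ω ^ 6945355872) = 35 := by
    rw [orderOf_pow, orderOf_teichmuller hω, hcard]
    norm_num
  have hdvd : ∀ j m f : ℕ, 0 < j → j < 35 → m + f = 6 →
      (Nat.digits 79 (6945355872 * j)).sum = 78 * m →
      (79 : R) ^ f ∣ gaussSum ((ω ^ 6945355872) ^ j) (traceChar F ψ) := by
    intro j m f hj hj' hmf hm
    rw [← pow_mul]
    exact_mod_cast prime_pow_dvd_gaussSum_teichmuller_pow (p := 79) (by rw [hcard]; norm_num)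
      (by norm_num) hω hψ (by omega) (by rw [hcard]; omega) (by rw [hmf]; exact hcard) hm
  generalize ω ^ 6945355872 = χ at hord hdvd
  have hχ : χ ^ 35 = 1 := hord ▸ pow_orderOf_eq_one χ
  have hχne : ∀ j, 0 < j → j < 35 → χ ^ j ≠ 1 := fun j hj hj' =>
    pow_ne_one_of_lt_orderOf hj.ne' (hord ▸ hj')
  have hfrob : ∀ j, gaussSum (χ ^ (79 * j % 35)) (traceChar F ψ) =
      gaussSum (χ ^ j) (traceChar F ψ) := fun j => by
    rw [← hord, pow_mod_orderOf, mul_comm, pow_mul, gaussSum_pow_char]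
  have hmul : ∀ i j, 0 < i → i < 35 → i + j = 35 →
      gaussSum (χ ^ i) (traceChar F ψ) * gaussSum (χ ^ j) (traceChar F ψ) = 79 ^ 6 := by
    intro i j hi hi' hij
    have hinv : (χ ^ i)⁻¹ = χ ^ j := inv_eq_of_mul_eq_one_right (by rw [← pow_add, hij, hχ])
    have hneg : (χ ^ j) (-1) = 1 := MulChar.apply_neg_one_of_odd_pow_eq_one (n := 35)
      (by decide) (by rw [pow_right_comm, hχ, one_pow])
    rw [← hinv, gaussSum_mul_gaussSum_inv (hχne i hi hi') (traceChar_ne_one hψ), hinv, hneg, hcard]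
    norm_num
  have hζ : IsPrimitiveRoot (ξ ^ 6945355872) 35 :=
    hξ.pow (by rw [hcard]; norm_num) (by rw [hcard]; norm_num)
  obtain ⟨T, hT, hT', hg⟩ := exists_periods_gaussSum_pow_eq (p := 79) (by norm_num : 0 < 35)
    (by norm_num) hχ hζ hψ (by norm_num)
  have := exists_eq_of_periods h hζ hT hT' hg (hdvd 1 2 4 (by norm_num) (by norm_num) rfl ?_)
    (hdvd 2 3 3 (by norm_num) (by norm_num) rfl ?_)
    (hdvd 3 3 3 (by norm_num) (by norm_num) rfl ?_)
    (hdvd 34 4 2 (by norm_num) (by norm_num) rfl ?_)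
    ?_ (hmul 1 34 (by norm_num) (by norm_num) rfl) ?_ ?_ ?_
  · rw [pow_one] at this
    exact ⟨χ, hord, this⟩
  · norm_num
  · norm_num
  · norm_num
  · norm_num
  · rw [pow_zero, gaussSum_one_left (traceChar_ne_one hψ)]
  · rw [← hmul 2 33 (by norm_num) (by norm_num) rfl]
    exact congrArg _ ((hfrob 27).trans (hfrob 3)).symm
  · rw [← hmul 7 28 (by norm_num) (by norm_num) rfl, sq]
    exact congrArg _ (hfrob 7).symm
  · rw [← hmul 14 21 (by norm_num) (by norm_num) rfl, sq]
    exact congrArg _ (hfrob 14).symm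

theorem exists_valuationSubring_not_isUnit {K : Type*} [Field K] [CharZero K] {q : ℕ}
    (hq : q.Prime) : ∃ A : ValuationSubring K, ¬ IsUnit (q : A) := by
  let S : Subring K := (Int.castRingHom K).range
  have hI : Ideal.span {(q : S)} ≠ ⊤ := by
    rw [Ne, Ideal.span_singleton_eq_top, isUnit_iff_exists_inv]
    rintro ⟨⟨-, n, rfl⟩, hn⟩
    have h1 : ((q * n : ℤ) : K) = (1 : ℤ) := by
      simpa [S] using congrArg (S.subtype) hn
    have h2 : (q : ℤ) ∣ 1 := ⟨n, (Int.cast_injective h1).symm⟩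
    exact hq.one_lt.ne' (by exact_mod_cast Int.eq_one_of_dvd_one (by positivity) h2)
  obtain ⟨A, -, hA⟩ := Ideal.image_subset_nonunits_valuationSubring _ hI
  refine ⟨A, ?_⟩
  have hmem : ((q : A) : K) ∈ A.nonunits :=
    hA ⟨(q : S), Ideal.mem_span_singleton_self _, by simp⟩
  exact ValuationSubring.coe_mem_nonunits_iff.1 hmem

theorem ValuationSubring.mem_of_pow_eq_one {K : Type*} [Field K] (A : ValuationSubring K) {x : K}
    {n : ℕ} (hn : 0 < n) (hx : x ^ n = 1) : x ∈ A := by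
  rcases A.mem_or_inv_mem x with h | h
  · exact h
  · have hx' : x = x⁻¹ ^ (n - 1) := by
      have hx0 : x ≠ 0 := by
        rintro rfl
        simp [hn.ne'] at hx
      rw [inv_pow, ← mul_eq_one_iff_eq_inv₀ (pow_ne_zero _ hx0), ← pow_succ',
        Nat.sub_add_cancel hn, hx]
    rw [hx']
    exact pow_mem h _

theorem map_gaussSum {F R S : Type*} [CommRing F] [Fintype F] [CommRing R] [CommRing S]
    (f : R →+* S) (χ : MulChar F R) (ψ : AddChar F R) :
    f (gaussSum χ ψ) = gaussSum (χ.ringHomComp f) (f.compAddChar ψ) := by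
  simp [gaussSum, MulChar.ringHomComp_apply]

section Complex

variable {F : Type*} [Field F] [Fintype F] [Fact (Nat.Prime 79)] [Algebra (ZMod 79) F]

theorem exists_complex_gaussSum_order_35 (hcard : Fintype.card F = 79 ^ 6) :
    ∃ χ : MulChar F ℂ, orderOf χ = 35 ∧ ∃ s t : ℂ, s ^ 2 = 5 ∧ t ^ 2 = -7 ∧
      2 * gaussSum χ (traceChar F (ZMod.stdAddChar (N := 79))) =
        79 ^ 2 * (1 - 3 * (s * t)) * (4 + 3 * t) ∧
      2 * gaussSum (χ ^ 2) (traceChar F (ZMod.stdAddChar (N := 79))) =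
        79 ^ 2 * (1 + 3 * (s * t)) * (4 + 3 * t) ∧
      2 * gaussSum (χ ^ 3) (traceChar F (ZMod.stdAddChar (N := 79))) =
        79 ^ 2 * (1 - 3 * (s * t)) * (4 - 3 * t) ∧
      2 * gaussSum (χ ^ 34) (traceChar F (ZMod.stdAddChar (N := 79))) =
        79 ^ 2 * (1 + 3 * (s * t)) * (4 - 3 * t) := by
  obtain ⟨A, hA⟩ := exists_valuationSubring_not_isUnit (K := ℂ) (Fact.out : Nat.Prime 79)
  have hinj : Function.Injective A.subtype := Subtype.val_injective
  have hprim : ∀ n : ℕ, n ≠ 0 → ∃ ζ : A, IsPrimitiveRoot ζ n ∧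
      (ζ : ℂ) = Complex.exp (2 * Real.pi * Complex.I / n) := fun n hn => by
    have h := Complex.isPrimitiveRoot_exp n hn
    exact ⟨⟨_, A.mem_of_pow_eq_one (Nat.pos_of_ne_zero hn) h.pow_eq_one⟩,
      IsPrimitiveRoot.of_map_of_injective (f := A.subtype) h hinj, rfl⟩
  obtain ⟨ξ, hξ, -⟩ := hprim (Fintype.card F - 1) (by rw [hcard]; norm_num)
  obtain ⟨ζ, hζ, hζ'⟩ := hprim 79 (by norm_num)
  let ψ : AddChar (ZMod 79) A := AddChar.zmodChar 79 hζ.pow_eq_one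
  have hψ : ψ ≠ 1 := by
    rw [AddChar.zmod_char_ne_one_iff, AddChar.zmodChar_apply, ZMod.val_one, pow_one]
    exact hζ.ne_one (by norm_num)
  have hψ' : A.subtype.compAddChar (traceChar F ψ) =
      traceChar F (ZMod.stdAddChar (N := 79)) := by
    ext x
    change ((ψ (Algebra.trace (ZMod 79) F x) : A) : ℂ) =
      ZMod.stdAddChar (Algebra.trace (ZMod 79) F x)
    rw [ZMod.stdAddChar_apply, ZMod.toCircle_apply, AddChar.zmodChar_apply, SubmonoidClass.coe_pow,
      hζ', ← Complex.exp_nat_mul]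
    congr 1
    push_cast
    ring
  obtain ⟨χ, hχ, s, t, hs, ht, h⟩ := exists_gaussSum_order_35 hcard (by exact_mod_cast hA) hξ hψ
  have hmap : ∀ j, A.subtype (gaussSum (χ ^ j) (traceChar F ψ)) =
      gaussSum (χ.ringHomComp A.subtype ^ j) (traceChar F ZMod.stdAddChar) := fun j => by
    rw [map_gaussSum, hψ', MulChar.ringHomComp_pow]
  refine ⟨χ.ringHomComp A.subtype, ?_, A.subtype s, A.subtype t, ?_, ?_, ?_⟩
  · rw [← hχ]
    exact orderOf_injective (MulChar.ringHomCompHom A.subtype)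
      (MulChar.injective_ringHomComp hinj) χ
  · rw [← map_pow, hs, map_ofNat]
  · rw [← map_pow, ht, map_neg, map_ofNat]
  · obtain ⟨h₁, h₂, h₃, h₄⟩ := h
    have hmap' := hmap 1
    rw [pow_one, pow_one] at hmap'
    rw [← hmap', ← hmap, ← hmap, ← hmap]
    simp only [← map_ofNat A.subtype, ← map_one A.subtype, ← map_mul, ← map_add, ← map_sub,
      ← map_pow]
    exact ⟨congrArg _ h₁, congrArg _ h₂, congrArg _ h₃, congrArg _ h₄⟩

theorem gaussSum_pow_eq_of_modEq {R : Type*} [CommRing R] {χ : MulChar F R} (hχ : χ ^ 35 = 1)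
    (ψ : AddChar (ZMod 79) R) {i j : ℕ} (h : 79 * i ≡ j [MOD 35]) :
    gaussSum (χ ^ j) (traceChar F ψ) = gaussSum (χ ^ i) (traceChar F ψ) := by
  rw [pow_eq_pow_mod j hχ, ← h, ← pow_eq_pow_mod _ hχ, mul_comm, pow_mul, gaussSum_pow_char]

theorem exists_gaussSum_order_35_of_sq_eq {R : Type*} [CommRing R] [IsDomain R]
    (ψ : AddChar (ZMod 79) R)
    (h : ∃ χ : MulChar F R, orderOf χ = 35 ∧ ∃ s t : R, s ^ 2 = 5 ∧ t ^ 2 = -7 ∧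
      2 * gaussSum χ (traceChar F ψ) = 79 ^ 2 * (1 - 3 * (s * t)) * (4 + 3 * t) ∧
      2 * gaussSum (χ ^ 2) (traceChar F ψ) = 79 ^ 2 * (1 + 3 * (s * t)) * (4 + 3 * t) ∧
      2 * gaussSum (χ ^ 3) (traceChar F ψ) = 79 ^ 2 * (1 - 3 * (s * t)) * (4 - 3 * t) ∧
      2 * gaussSum (χ ^ 34) (traceChar F ψ) = 79 ^ 2 * (1 + 3 * (s * t)) * (4 - 3 * t))
    {s t : R} (hs : s ^ 2 = 5) (ht : t ^ 2 = -7) :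
    ∃ χ : MulChar F R, orderOf χ = 35 ∧
      2 * gaussSum χ (traceChar F ψ) = 79 ^ 2 * (1 - 3 * (s * t)) * (4 + 3 * t) ∧
      2 * gaussSum (χ ^ 2) (traceChar F ψ) = 79 ^ 2 * (1 + 3 * (s * t)) * (4 + 3 * t) ∧
      2 * gaussSum (χ ^ 3) (traceChar F ψ) = 79 ^ 2 * (1 - 3 * (s * t)) * (4 - 3 * t) ∧
      2 * gaussSum (χ ^ 34) (traceChar F ψ) = 79 ^ 2 * (1 + 3 * (s * t)) * (4 - 3 * t) := by
  obtain ⟨χ, hord, a, b, ha, hb, h₁, h₂, h₃, h₄⟩ := h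
  have hχ : χ ^ 35 = 1 := hord ▸ pow_orderOf_eq_one χ
  have hord' : ∀ j, Nat.Coprime 35 j → orderOf (χ ^ j) = 35 := fun j hj => by
    rw [Nat.Coprime.orderOf_pow (by rwa [hord]), hord]
  have hfrob : ∀ {i j : ℕ}, 79 * i ≡ j [MOD 35] →
      gaussSum (χ ^ j) (traceChar F ψ) = gaussSum (χ ^ i) (traceChar F ψ) :=
    fun h => gaussSum_pow_eq_of_modEq hχ ψ h
  have e9 : gaussSum (χ ^ 9) (traceChar F ψ) = gaussSum χ (traceChar F ψ) := by
    simpa using hfrob (i := 1) (j := 9) (by decide)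
  have e4 : gaussSum (χ ^ 4) (traceChar F ψ) = gaussSum χ (traceChar F ψ) := by
    simpa using (hfrob (i := 4) (j := 1) (by decide)).symm
  have e6 : gaussSum (χ ^ 6) (traceChar F ψ) = gaussSum (χ ^ 34) (traceChar F ψ) := by
    rw [hfrob (i := 24) (j := 6) (by decide), hfrob (i := 26) (j := 24) (by decide),
      hfrob (i := 34) (j := 26) (by decide)]
  have e33 : gaussSum (χ ^ 33) (traceChar F ψ) = gaussSum (χ ^ 3) (traceChar F ψ) := by
    rw [hfrob (i := 27) (j := 33) (by decide), hfrob (i := 3) (j := 27) (by decide)]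
  have e32 : gaussSum (χ ^ 32) (traceChar F ψ) = gaussSum (χ ^ 2) (traceChar F ψ) := by
    rw [hfrob (i := 23) (j := 32) (by decide), hfrob (i := 22) (j := 23) (by decide),
      hfrob (i := 18) (j := 22) (by decide), hfrob (i := 2) (j := 18) (by decide)]
  have e68 : χ ^ 68 = χ ^ 33 := pow_eq_pow_mod 68 hχ
  have e102 : χ ^ 102 = χ ^ 32 := pow_eq_pow_mod 102 hχ
  have e1156 : χ ^ 1156 = χ := by simpa using pow_eq_pow_mod 1156 hχ
  rcases sq_eq_sq_iff_eq_or_eq_neg.1 (ha.trans hs.symm) with rfl | rfl <;>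
    rcases sq_eq_sq_iff_eq_or_eq_neg.1 (hb.trans ht.symm) with rfl | rfl
  · exact ⟨χ, hord, h₁, h₂, h₃, h₄⟩
  · refine ⟨χ ^ 34, hord' 34 (by decide), ?_⟩
    simp only [← pow_mul, Nat.reduceMul, e68, e102, e1156, e33, e32, h₁, h₂, h₃, h₄]
    refine ⟨?_, ?_, ?_, ?_⟩ <;> ring
  · refine ⟨χ ^ 2, hord' 2 (by decide), ?_⟩
    simp only [← pow_mul, Nat.reduceMul, e68, e4, e6, e33, h₁, h₂, h₃, h₄]
    refine ⟨?_, ?_, ?_, ?_⟩ <;> ring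
  · refine ⟨χ ^ 3, hord' 3 (by decide), ?_⟩
    simp only [← pow_mul, Nat.reduceMul, e102, e6, e9, e32, h₁, h₂, h₃, h₄]
    refine ⟨?_, ?_, ?_, ?_⟩ <;> ring

end Complex

/-- **Evaluation of a Gauss sum of order 35 over `F_{79⁶}`.**
There exists a multiplicative character `χ` of order `35` of the finite field `F` with
`79⁶` elements such that the Gauss sum
`G(χ) = ∑ x, χ x · exp(2πi·T(x)/79)` equals `(79²/2)·(1 − 3i√35)·(4 + 3i√7)`; moreover
the Gauss sums at `χ²`, `χ³` and at the complex-conjugate character `χ̄ = χ⁻¹`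
(given by `x ↦ conj (χ x)`) equal `(79²/2)·(1 + 3i√35)·(4 + 3i√7)`,
`(79²/2)·(1 − 3i√35)·(4 − 3i√7)` and `(79²/2)·(1 + 3i√35)·(4 − 3i√7)` respectively. -/
theorem gauss_sum_order_35_card_79_pow_6
    (F : Type) [Field F] [Fintype F] [Algebra (ZMod 79) F]
    (hcard : Fintype.card F = 79 ^ 6) :
    ∃ χ : MulChar F ℂ, orderOf χ = 35 ∧
    (∑ x : F, χ x * Complex.exp (2 * (Real.pi : ℂ) * Complex.I *
        ((Algebra.trace (ZMod 79) F x).val : ℂ) / 79)) =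
      (79 ^ 2 / 2) * (1 - 3 * Complex.I * (Real.sqrt 35 : ℂ)) *
        (4 + 3 * Complex.I * (Real.sqrt 7 : ℂ)) ∧
    (∑ x : F, (χ ^ 2) x * Complex.exp (2 * (Real.pi : ℂ) * Complex.I *
        ((Algebra.trace (ZMod 79) F x).val : ℂ) / 79)) =
      (79 ^ 2 / 2) * (1 + 3 * Complex.I * (Real.sqrt 35 : ℂ)) *
        (4 + 3 * Complex.I * (Real.sqrt 7 : ℂ)) ∧
    (∑ x : F, (χ ^ 3) x * Complex.exp (2 * (Real.pi : ℂ) * Complex.I *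
        ((Algebra.trace (ZMod 79) F x).val : ℂ) / 79)) =
      (79 ^ 2 / 2) * (1 - 3 * Complex.I * (Real.sqrt 35 : ℂ)) *
        (4 - 3 * Complex.I * (Real.sqrt 7 : ℂ)) ∧
    (∑ x : F, (starRingEnd ℂ) (χ x) * Complex.exp (2 * (Real.pi : ℂ) * Complex.I *
        ((Algebra.trace (ZMod 79) F x).val : ℂ) / 79)) =
      (79 ^ 2 / 2) * (1 + 3 * Complex.I * (Real.sqrt 35 : ℂ)) *
        (4 - 3 * Complex.I * (Real.sqrt 7 : ℂ)) := by
  have : Fact (Nat.Prime 79) := ⟨by norm_num⟩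
  have hs : (Real.sqrt 5 : ℂ) ^ 2 = 5 := by
    exact_mod_cast congrArg ((↑) : ℝ → ℂ) (Real.sq_sqrt (by norm_num : (0 : ℝ) ≤ 5))
  have hr : (Real.sqrt 7 : ℂ) ^ 2 = 7 := by
    exact_mod_cast congrArg ((↑) : ℝ → ℂ) (Real.sq_sqrt (by norm_num : (0 : ℝ) ≤ 7))
  have ht : (Complex.I * (Real.sqrt 7 : ℂ)) ^ 2 = -7 := by
    rw [mul_pow, hr, Complex.I_sq, neg_one_mul]
  have h35 : (Real.sqrt 35 : ℂ) = Real.sqrt 5 * Real.sqrt 7 := by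
    rw [← Complex.ofReal_mul, ← Real.sqrt_mul (by norm_num)]
    norm_num
  have hsum : ∀ f : F → ℂ, ∑ x : F, f x * Complex.exp (2 * (Real.pi : ℂ) * Complex.I *
      ((Algebra.trace (ZMod 79) F x).val : ℂ) / 79) =
      ∑ x : F, f x * traceChar F (ZMod.stdAddChar (N := 79)) x := fun f => by
    refine Finset.sum_congr rfl fun x _ => ?_
    rw [traceChar_apply, ZMod.stdAddChar_apply, ZMod.toCircle_apply]
    norm_cast
  obtain ⟨χ, hord, h₁, h₂, h₃, h₄⟩ := exists_gaussSum_order_35_of_sq_eq ZMod.stdAddChar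
    (exists_complex_gaussSum_order_35 hcard) hs ht
  have hconj : ∀ x, (starRingEnd ℂ) (χ x) = (χ ^ 34) x := fun x => by
    have hinv : χ⁻¹ = χ ^ 34 := inv_eq_of_mul_eq_one_right (by
      rw [← pow_succ', ← pow_orderOf_eq_one χ, hord])
    rw [← hinv]
    exact MulChar.star_apply' χ x
  refine ⟨χ, hord, ?_⟩
  simp only [hconj, hsum, h35]
  simp only [gaussSum] at h₁ h₂ h₃ h₄
  refine ⟨?_, ?_, ?_, ?_⟩ <;> apply mul_left_cancel₀ (two_ne_zero (α := ℂ))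
  · rw [h₁]
    ring
  · rw [h₂]
    ring
  · rw [h₃]
    ring
  · rw [h₄]
    ring
end
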